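/- arXiv:1605.02882 — 5 statements merged into one kernel-verified Lean document; each statement's English description precedes it below -/
import Mathlib

section
/- There exists a universal constant C > 0 such that the following holds. Let n ≥ 2 and t ≥ 1 be integers, and let 𝒮 be a finite collection of subsets of V = {1,…,n} such that every element i ∈ V lies in at most t sets of 𝒮. Then there exists a coloring χ : V → {-1,1} such that for every set S ∈ 𝒮, |∑_{i∈S} χ(i)| ≤ C·√(t·log n). -/
theorem bf_exp_le (t : ℝ) : Real.exp t ≤ t + Real.exp (t ^ 2) := by
  have h1 : t ^ 2 + 1 ≤ Real.exp (t ^ 2) := Real.add_one_le_exp _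
  rcases le_or_gt |t| 1 with h | h
  · have := (abs_le.mp (Real.abs_exp_sub_one_sub_id_le h)).2
    linarith
  · rcases lt_abs.mp h with h | h
    · have : Real.exp t ≤ Real.exp (t ^ 2) := Real.exp_le_exp.mpr (by nlinarith)
      linarith
    · have : Real.exp t ≤ 1 := Real.exp_le_one_iff.mpr (by linarith)
      nlinarith

theorem bf_hoeff (y d : ℝ) (hy : |y| ≤ 1) :
    Real.cosh d + y * Real.sinh d ≤ Real.exp (y * d + 4 * d ^ 2) := by
  obtain ⟨hy1, hy2⟩ := abs_le.mp hy
  have e1 : Real.exp d = Real.exp (y * d) * Real.exp ((1 - y) * d) := by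
    rw [← Real.exp_add]; ring_nf
  have e2 : Real.exp (-d) = Real.exp (y * d) * Real.exp (-(1 + y) * d) := by
    rw [← Real.exp_add]; ring_nf
  have a1 : Real.exp ((1 - y) * d) ≤ (1 - y) * d + Real.exp (4 * d ^ 2) :=
    (bf_exp_le _).trans (by
      gcongr
      rw [mul_pow]
      gcongr
      nlinarith)
  have a2 : Real.exp (-(1 + y) * d) ≤ -(1 + y) * d + Real.exp (4 * d ^ 2) :=
    (bf_exp_le _).trans (by
      gcongr
      rw [mul_pow]
      gcongr
      nlinarith)
  rw [Real.cosh_eq, Real.sinh_eq, e1, e2, Real.exp_add]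
  have b1 := mul_le_mul_of_nonneg_left a1 (by linarith : (0:ℝ) ≤ (1 + y) / 2)
  have b2 := mul_le_mul_of_nonneg_left a2 (by linarith : (0:ℝ) ≤ (1 - y) / 2)
  have b3 := mul_le_mul_of_nonneg_left (add_le_add b1 b2) (Real.exp_pos (y * d)).le
  refine le_trans (le_of_eq ?_) (b3.trans (le_of_eq ?_)) <;> ring

theorem bf_sinh (g : ℝ) : |Real.sinh g| ≤ 2 * |g| * Real.cosh g := by
  have key : ∀ g : ℝ, 0 ≤ g → Real.sinh g ≤ 2 * g * Real.cosh g := by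
    intro g hg
    rw [Real.sinh_eq, Real.cosh_eq]
    have e : Real.exp (-g) = Real.exp g * Real.exp (-(2 * g)) := by
      rw [← Real.exp_add]; ring_nf
    have h := Real.add_one_le_exp (-(2 * g))
    have h2 := mul_le_mul_of_nonneg_left h (Real.exp_pos g).le
    have h3 : 0 ≤ g * Real.exp (-g) := by positivity
    rw [← e] at h2
    nlinarith
  rcases le_total 0 g with h | h
  · rw [abs_of_nonneg (Real.sinh_nonneg_iff.mpr h), abs_of_nonneg h]
    exact key g h
  · rw [abs_of_nonpos (Real.sinh_nonpos_iff.mpr h), abs_of_nonpos h]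
    have := key (-g) (by linarith)
    rwa [Real.sinh_neg, Real.cosh_neg] at this

theorem bf_abs_sinh_le (g : ℝ) : |Real.sinh g| ≤ Real.cosh g :=
  abs_le_of_sq_le_sq (by have := Real.cosh_sq g; linarith) (Real.cosh_pos g).le

theorem bf_N_lb (x g : ℝ) : (1 - |x|) * Real.cosh g ≤ Real.cosh g + x * Real.sinh g := by
  have h1 := neg_abs_le (x * Real.sinh g)
  rw [abs_mul] at h1
  have h2 := mul_le_mul_of_nonneg_left (bf_abs_sinh_le g) (abs_nonneg x)
  linarith

theorem bf_N_pos (x g : ℝ) (hx : |x| ≤ 1) : 0 < Real.cosh g + x * Real.sinh g := by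
  obtain ⟨h1, h2⟩ := abs_le.mp hx
  rw [Real.cosh_eq, Real.sinh_eq]
  have p := Real.exp_pos g
  have q := Real.exp_pos (-g)
  rcases le_or_gt 0 x with h | h <;> nlinarith

theorem bf_upd (x g d : ℝ) (hx : |x| ≤ 1) :
    Real.exp (-(x * (g + d))) * (Real.cosh (g + d) + x * Real.sinh (g + d)) ≤
      Real.exp (-(x * g)) * (Real.cosh g + x * Real.sinh g) *
        Real.exp (4 * |g * d| + 4 * d ^ 2) := by
  have hN := bf_N_pos x g hx
  set N := Real.cosh g + x * Real.sinh g with hNd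
  set y := (Real.sinh g + x * Real.cosh g) / N with hy
  have hyN : y * N = Real.sinh g + x * Real.cosh g := by
    rw [hy]; field_simp
  have hx2 : x ^ 2 ≤ 1 := by rw [← sq_abs]; nlinarith [abs_nonneg x]
  have hy1 : |y| ≤ 1 := by
    rw [hy, abs_div, abs_of_pos hN, div_le_one hN]
    apply abs_le_of_sq_le_sq _ hN.le
    have := Real.cosh_sq g
    rw [hNd]
    nlinarith
  have hyx : |y - x| ≤ 4 * |g| := by
    have e : (y - x) * N = (1 - x ^ 2) * Real.sinh g := by
      rw [sub_mul, hyN, hNd]; ring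
    have e2 : |y - x| * N = (1 - x ^ 2) * |Real.sinh g| := by
      have e3 : |(y - x) * N| = |(1 - x ^ 2) * Real.sinh g| := by rw [e]
      rwa [abs_mul, abs_mul, abs_of_pos hN, abs_of_nonneg (by linarith : 0 ≤ 1 - x ^ 2)] at e3
    have h1 := bf_N_lb x g
    rw [← hNd] at h1
    have h2 : (1 - x ^ 2) ≤ 2 * (1 - |x|) := by rw [← sq_abs]; nlinarith [abs_nonneg x]
    refine le_of_mul_le_mul_right ?_ hN
    rw [e2]
    calc (1 - x ^ 2) * |Real.sinh g| ≤ (2 * (1 - |x|)) * (2 * |g| * Real.cosh g) := by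
          gcongr
          exact bf_sinh g
      _ = 4 * |g| * ((1 - |x|) * Real.cosh g) := by ring
      _ ≤ _ := by gcongr
  have e : Real.cosh (g + d) + x * Real.sinh (g + d) = N * (Real.cosh d + y * Real.sinh d) := by
    rw [Real.cosh_add, Real.sinh_add]
    have : N * (Real.cosh d + y * Real.sinh d) = N * Real.cosh d + (y * N) * Real.sinh d := by ring
    rw [this, hyN, hNd]; ring
  rw [e]
  have h := bf_hoeff y d hy1
  have hh : y * d - x * d ≤ 4 * |g * d| := by
    rw [← sub_mul, abs_mul]
    refine (le_abs_self _).trans ?_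
    rw [abs_mul]
    nlinarith [abs_nonneg d]
  calc _ ≤ Real.exp (-(x * (g + d))) * (N * Real.exp (y * d + 4 * d ^ 2)) := by gcongr
    _ = N * Real.exp (-(x * (g + d)) + (y * d + 4 * d ^ 2)) := by
        rw [Real.exp_add (-(x * (g + d)))]; ring
    _ ≤ N * Real.exp (-(x * g) + (4 * |g * d| + 4 * d ^ 2)) := by
        gcongr N * Real.exp ?_
        linarith
    _ = _ := by rw [Real.exp_add (-(x * g))]; ring

theorem bf_quad (g d R S D : ℝ) (hR : 0 ≤ R) (hS : 0 ≤ S) (hRS : R + S ≤ 1)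
    (hd : d ^ 2 ≤ S * D) (hg : R = 0 → g = 0) (hD : 0 ≤ D) :
    |g * d| + d ^ 2 ≤ D + g ^ 2 / R - (g + d) ^ 2 / (R + S) + (g + d) ^ 2 - g ^ 2 := by
  rcases hS.eq_or_lt with h | hS
  · subst h
    have : d = 0 := by nlinarith
    subst this
    simp; exact hD
  rcases hR.eq_or_lt with h | hR
  · subst h
    rw [hg rfl]
    simp
    rw [div_le_iff₀ hS]; linarith
  have hD' : d ^ 2 / S ≤ D := by rw [div_le_iff₀ hS]; linarith
  have hid : d ^ 2 / S + g ^ 2 / R - (g + d) ^ 2 / (R + S) = (R * d - S * g) ^ 2 / (R * S * (R + S)) := by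
    field_simp; ring
  have hge : (R * d - S * g) ^ 2 / (R * S) ≤ (R * d - S * g) ^ 2 / (R * S * (R + S)) := by
    apply div_le_div_of_nonneg_left (by positivity) (by positivity)
    exact mul_le_of_le_one_right (by positivity) hRS
  have hid2 : (R * d - S * g) ^ 2 / (R * S) = (R / S) * d ^ 2 + (S / R) * g ^ 2 - 2 * (g * d) := by
    field_simp; ring
  have ham : 2 * |g * d| ≤ (R / S) * d ^ 2 + (S / R) * g ^ 2 := by
    have h0 : 2 * |g * d| = 2 * (|g| * |d|) := by rw [abs_mul]
    have : (R / S) * d ^ 2 + (S / R) * g ^ 2 - 2 * (|g| * |d|) = (R * |d| - S * |g|) ^ 2 / (R * S) := by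
      rw [← sq_abs d, ← sq_abs g]; field_simp; ring
    have h3 : 0 ≤ (R * |d| - S * |g|) ^ 2 / (R * S) := by positivity
    linarith
  have := abs_nonneg (g * d)
  nlinarith

/-- moving until some coordinate freezes -/
theorem bf_move {V : Type*} (A : Finset V) (z u : V → ℝ) (p : V) (hp : p ∈ A)
    (hu : u p ≠ 0) (hz : ∀ i ∈ A, |z i| ≤ 1) :
    ∃ δ : ℝ, 0 ≤ δ ∧ (∀ i ∈ A, |z i + δ * u i| ≤ 1) ∧
      ∃ j ∈ A, (z j + δ * u j = 1 ∨ z j + δ * u j = -1) := by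
  classical
  let f : V → ℝ := fun i => (|u i| - z i * u i) / u i ^ 2
  obtain ⟨j, hj, hmin⟩ := Finset.exists_min_image (A.filter fun i => u i ≠ 0) f
    ⟨p, by simp [hp, hu]⟩
  simp only [Finset.mem_filter] at hj hmin
  have hf0 : 0 ≤ f j := by
    have h1 := hz j hj.1
    have : z j * u j ≤ |u j| := by
      refine (le_abs_self _).trans ?_
      rw [abs_mul]
      exact mul_le_of_le_one_left (abs_nonneg _) h1
    apply div_nonneg (by linarith) (sq_nonneg _)
  refine ⟨f j, hf0, ?_, j, hj.1, ?_⟩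
  · intro i hi
    by_cases h : u i = 0
    · simpa [h] using hz i hi
    · have h1 := hmin i ⟨hi, h⟩
      have hzi := abs_le.mp (hz i hi)
      have h2 : f j * u i ^ 2 ≤ |u i| - z i * u i := by
        have h3 : f i * u i ^ 2 = |u i| - z i * u i := by
          simp only [f]; field_simp
        rw [← h3]; gcongr
      rcases lt_or_gt_of_ne h with h | h
      · rw [abs_of_neg h] at h2
        rw [abs_le]
        constructor <;> nlinarith
      · rw [abs_of_pos h] at h2
        rw [abs_le]
        constructor <;> nlinarith [mul_nonneg hf0 h.le]
  · rcases lt_or_gt_of_ne hj.2 with h | h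
    · right
      simp only [f]
      rw [abs_of_neg h]
      have := h.ne
      field_simp; ring
    · left
      simp only [f]
      rw [abs_of_pos h]
      have := h.ne'
      field_simp; ring

section
variable {E : Type*} [NormedAddCommGroup E] [InnerProductSpace ℝ E] [FiniteDimensional ℝ E]

theorem bf_proj (U U' : Submodule ℝ E) (hU : U' ≤ U) (θ s : E) (hs : s ∈ U) (hs' : s ∈ U'ᗮ) :
    (inner ℝ s θ) ^ 2 ≤ ‖s‖ ^ 2 * (‖U.starProjection θ‖ ^ 2 - ‖U'.starProjection θ‖ ^ 2) := by
  have h1 : inner ℝ s θ = inner ℝ s (U.starProjection θ - U'.starProjection θ) := by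
    have a : inner ℝ s (U.starProjection θ) = inner ℝ s θ := by
      rw [← Submodule.inner_starProjection_left_eq_right, Submodule.starProjection_eq_self_iff.mpr hs]
    have b : inner ℝ s (U'.starProjection θ) = 0 :=
      Submodule.inner_left_of_mem_orthogonal (Submodule.starProjection_apply_mem _ _) hs'
    rw [inner_sub_right, a, b, sub_zero]
  have h2 : ‖U.starProjection θ‖ ^ 2 - ‖U'.starProjection θ‖ ^ 2 =
      ‖U.starProjection θ - U'.starProjection θ‖ ^ 2 := by
    have c : inner ℝ (U.starProjection θ) (U'.starProjection θ) = ‖U'.starProjection θ‖ ^ 2 := by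
      rw [Submodule.inner_starProjection_left_eq_right,
        Submodule.starProjection_eq_self_iff.mpr (hU (Submodule.starProjection_apply_mem _ _)),
        ← real_inner_self_eq_norm_sq, Submodule.inner_starProjection_left_eq_right,
        Submodule.starProjection_eq_self_iff.mpr (Submodule.starProjection_apply_mem _ _)]
    rw [norm_sub_sq_real, c]; ring
  rw [h1, h2, ← mul_pow]
  apply sq_le_sq'
  · have := neg_le_of_abs_le (abs_real_inner_le_norm s (U.starProjection θ - U'.starProjection θ))
    linarith
  · exact real_inner_le_norm _ _

theorem bf_proj_mono (U U' : Submodule ℝ E) (hU : U' ≤ U) (θ : E) :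
    ‖U'.starProjection θ‖ ^ 2 ≤ ‖U.starProjection θ‖ ^ 2 := by
  have : U'.starProjection θ = U'.starProjection (U.starProjection θ) := by
    have := Submodule.starProjection_comp_starProjection_of_le hU
    exact (congrArg (fun f => f θ) this).symm
  rw [this]
  gcongr
  exact Submodule.norm_starProjection_apply_le _ _

/-- potential inside a pivot phase: `U` span of the others, `v` pivot vector -/
noncomputable def bfPot (U : Submodule ℝ E) (v θ : E) : ℝ :=
  ‖U.starProjection θ‖ ^ 2 + (inner ℝ (v - U.starProjection v) θ) ^ 2 / ‖v - U.starProjection v‖ ^ 2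
    - (inner ℝ (v - U.starProjection v) θ) ^ 2

theorem bf_res_le (U : Submodule ℝ E) (v : E) (hv : ‖v‖ ≤ 1) : ‖v - U.starProjection v‖ ^ 2 ≤ 1 := by
  have h := Submodule.norm_sq_eq_add_norm_sq_starProjection v U
  rw [Submodule.starProjection_orthogonal_val] at h
  nlinarith [norm_nonneg v, sq_nonneg ‖U.starProjection v‖]

theorem bf_pot_ge (U : Submodule ℝ E) (v θ : E) (hv : ‖v‖ ≤ 1) :
    ‖U.starProjection θ‖ ^ 2 ≤ bfPot U v θ := by
  unfold bfPot
  have h := bf_res_le U v hv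
  set r := v - U.starProjection v
  rcases (sq_nonneg ‖r‖).eq_or_lt with h0 | h0
  · have : r = 0 := by simpa using h0.symm
    simp [this]
  · have := div_le_div_of_nonneg_left (sq_nonneg (inner ℝ r θ)) h0 h
    rw [div_one] at this
    linarith

theorem bf_pot_start (U W : Submodule ℝ E) (v θ : E) (hUW : U ≤ W) (hvW : v ∈ W) :
    bfPot U v θ + (inner ℝ (v - U.starProjection v) θ) ^ 2 ≤ ‖W.starProjection θ‖ ^ 2 := by
  unfold bfPot
  have h := bf_proj W U hUW θ (v - U.starProjection v)
    (W.sub_mem hvW (hUW (Submodule.starProjection_apply_mem _ _)))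
    (Submodule.sub_starProjection_mem_orthogonal _)
  have h2 := bf_proj_mono W U hUW θ
  set r := v - U.starProjection v
  rcases (sq_nonneg ‖r‖).eq_or_lt with h0 | h0
  · rw [← h0]; simp; linarith
  · have := (div_le_iff₀' h0).mpr h
    linarith

theorem bf_pot_upd (U U' : Submodule ℝ E) (hU : U' ≤ U) (v θ : E) (hv : ‖v‖ ≤ 1)
    (x : ℝ) (hx : |x| ≤ 1) (g g' : ℝ) (hg : g = inner ℝ (v - U.starProjection v) θ)
    (hg' : g' = inner ℝ (v - U'.starProjection v) θ) :
    Real.exp (-(x * g') + 4 * bfPot U' v θ) * (Real.cosh g' + x * Real.sinh g') ≤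
    Real.exp (-(x * g) + 4 * bfPot U v θ) * (Real.cosh g + x * Real.sinh g) := by
  set r := v - U.starProjection v with hr
  set r' := v - U'.starProjection v with hr'
  set s := U.starProjection v - U'.starProjection v with hs
  have hrs : r' = r + s := by rw [hr, hr', hs]; abel
  have hsU : s ∈ U := U.sub_mem (Submodule.starProjection_apply_mem _ _)
    (hU (Submodule.starProjection_apply_mem _ _))
  have hrU : r ∈ Uᗮ := Submodule.sub_starProjection_mem_orthogonal _
  have hsU' : s ∈ U'ᗮ := by
    have : s = r' - r := by rw [hrs]; abel
    rw [this]
    exact Submodule.sub_mem _ (Submodule.sub_starProjection_mem_orthogonal _)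
      (Submodule.orthogonal_le hU hrU)
  have hR' : ‖r'‖ ^ 2 = ‖r‖ ^ 2 + ‖s‖ ^ 2 := by
    rw [hrs, norm_add_sq_real, Submodule.inner_left_of_mem_orthogonal hsU hrU]; ring
  have h1 := bf_res_le U' v hv
  rw [← hr', hR'] at h1
  have hgd : g' = g + inner ℝ s θ := by rw [hg', hg, hrs, inner_add_left]
  have q := bf_quad g (inner ℝ s θ) (‖r‖ ^ 2) (‖s‖ ^ 2) _ (sq_nonneg _) (sq_nonneg _) h1
    (bf_proj U U' hU θ s hsU hsU') (by
      intro h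
      have : r = 0 := by simpa using h
      rw [hg, this, inner_zero_left]) (by have := bf_proj_mono U U' hU θ; linarith)
  rw [← hR', ← hgd] at q
  have hup := bf_upd x g (inner ℝ s θ) hx
  rw [← hgd] at hup
  have hN := bf_N_pos x g hx
  have hE : 4 * |g * inner ℝ s θ| + 4 * (inner ℝ s θ) ^ 2 + 4 * bfPot U' v θ ≤ 4 * bfPot U v θ := by
    unfold bfPot
    rw [← hr, ← hr', ← hg, ← hg']
    linarith
  calc _ = (Real.exp (-(x * g')) * (Real.cosh g' + x * Real.sinh g')) * Real.exp (4 * bfPot U' v θ) := by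
        rw [Real.exp_add]; ring
    _ ≤ _ := mul_le_mul_of_nonneg_right hup (Real.exp_pos _).le
    _ = (Real.cosh g + x * Real.sinh g) * Real.exp (-(x * g) + (4 * |g * inner ℝ s θ| + 4 * (inner ℝ s θ) ^ 2 + 4 * bfPot U' v θ)) := by
        rw [Real.exp_add (-(x * g)), Real.exp_add (_ + _) (4 * bfPot U' v θ)]; ring
    _ ≤ (Real.cosh g + x * Real.sinh g) * Real.exp (-(x * g) + 4 * bfPot U v θ) := by
        gcongr
    _ = _ := by ring
end

section
variable {E : Type*} [NormedAddCommGroup E] [InnerProductSpace ℝ E] [FiniteDimensional ℝ E]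

/-- span of the vectors indexed by `A` -/
def bfSpan {V : Type*} (b : V → E) (A : Finset V) : Submodule ℝ E :=
  Submodule.span ℝ (b '' (A : Set V))

theorem bfSpan_mono {V : Type*} (b : V → E) {A B : Finset V} (h : A ⊆ B) :
    bfSpan b A ≤ bfSpan b B :=
  Submodule.span_mono (Set.image_mono (by exact_mod_cast h))

/-- pivot phase term -/
noncomputable def bfTerm (U : Submodule ℝ E) (v θ : E) (x a : ℝ) : ℝ :=
  Real.exp (a - x * inner ℝ (v - U.starProjection v) θ + 4 * bfPot U v θ) *
    (Real.cosh (inner ℝ (v - U.starProjection v) θ) +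
      x * Real.sinh (inner ℝ (v - U.starProjection v) θ))

theorem bfTerm_upd (U U' : Submodule ℝ E) (hU : U' ≤ U) (v θ : E) (hv : ‖v‖ ≤ 1)
    (x a : ℝ) (hx : |x| ≤ 1) : bfTerm U' v θ x a ≤ bfTerm U v θ x a := by
  have h := mul_le_mul_of_nonneg_left (bf_pot_upd U U' hU v θ hv x hx _ _ rfl rfl) (Real.exp_pos a).le
  rw [← mul_assoc, ← mul_assoc, ← Real.exp_add, ← Real.exp_add] at h
  unfold bfTerm
  refine le_trans (le_of_eq ?_) (h.trans (le_of_eq ?_)) <;> ring_nf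

theorem bfTerm_start (U W : Submodule ℝ E) (v θ : E) (hUW : U ≤ W) (hvW : v ∈ W)
    (x a : ℝ) (hx : |x| ≤ 1) :
    bfTerm U v θ x a ≤ Real.exp (a + 4 * ‖W.starProjection θ‖ ^ 2) := by
  have h := bf_pot_start U W v θ hUW hvW
  unfold bfTerm
  set g := inner ℝ (v - U.starProjection v) θ
  have h2 := bf_hoeff x g hx
  calc _ ≤ _ := mul_le_mul_of_nonneg_left h2 (Real.exp_pos _).le
    _ ≤ _ := by
      rw [← Real.exp_add]
      apply Real.exp_le_exp.mpr
      linarith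

theorem bfTerm_end (U : Submodule ℝ E) (v θ : E) (hv : ‖v‖ ≤ 1)
    (x a : ℝ) (hx : x = 1 ∨ x = -1) :
    Real.exp (a + 4 * ‖U.starProjection θ‖ ^ 2) ≤ bfTerm U v θ x a := by
  have h := bf_pot_ge U v θ hv
  unfold bfTerm
  set g := inner ℝ (v - U.starProjection v) θ
  have e : Real.cosh g + x * Real.sinh g = Real.exp (x * g) := by
    rcases hx with rfl | rfl
    · simp [Real.cosh_add_sinh]
    · rw [neg_one_mul, neg_one_mul, ← Real.cosh_sub_sinh]; ring
  rw [e, ← Real.exp_add]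
  apply Real.exp_le_exp.mpr
  linarith

variable {V κ : Type*} [Fintype V] [DecidableEq V] [Fintype κ]

theorem bf_dir (b : V → E) (A : Finset V) (p : V) (hp : p ∈ A) :
    ∃ u : V → ℝ, u p = 1 ∧ (∀ i, i ∉ A → u i = 0) ∧
      ∑ i, u i • b i = b p - (bfSpan b (A.erase p)).starProjection (b p) := by
  have hm := Submodule.starProjection_apply_mem (bfSpan b (A.erase p)) (b p)
  unfold bfSpan at hm
  rw [Submodule.mem_span_image_finset_iff_exists_fun'] at hm
  obtain ⟨c, hc⟩ := hm
  refine ⟨fun i => if i = p then 1 else if i ∈ A then - c i else 0, by simp, ?_, ?_⟩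
  · intro i hi
    have : i ≠ p := fun h => hi (h ▸ hp)
    simp [this, hi]
  · unfold bfSpan
    rw [← hc, ← Finset.add_sum_erase _ _ (Finset.mem_univ p)]
    simp only [if_true, one_smul, sub_eq_add_neg]
    congr 1
    rw [← Finset.sum_neg_distrib]
    symm
    apply Finset.sum_subset_zero_on_sdiff (Finset.erase_subset_erase _ (Finset.subset_univ _))
    · intro i hi
      simp only [Finset.mem_sdiff, Finset.mem_erase, Finset.mem_univ] at hi
      have h1 : i ≠ p := hi.1.1
      have h2 : i ∉ A := fun h => hi.2 ⟨h1, h⟩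
      simp [h1, h2]
    · intro i hi
      simp only [Finset.mem_erase] at hi
      simp [hi.1, hi.2]

theorem bf_main (b : V → E) (hb : ∀ i, ‖b i‖ ≤ 1) (θ : κ → E) : ∀ (N : ℕ) (A : Finset V),
    A.card = N →
    (∀ z : V → ℝ, (∀ i, |z i| ≤ 1) → (∀ i, i ∉ A → z i = 1 ∨ z i = -1) →
      ∃ χ : V → ℝ, (∀ i, χ i = 1 ∨ χ i = -1) ∧
        ∑ k, Real.exp (inner ℝ (∑ i, χ i • b i) (θ k)) ≤
        ∑ k, Real.exp (inner ℝ (∑ i, z i • b i) (θ k) +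
          4 * ‖(bfSpan b A).starProjection (θ k)‖ ^ 2)) ∧
    (∀ p ∈ A, ∀ z : V → ℝ, (∀ i, |z i| ≤ 1) → (∀ i, i ∉ A → z i = 1 ∨ z i = -1) →
      ∃ χ : V → ℝ, (∀ i, χ i = 1 ∨ χ i = -1) ∧
        ∑ k, Real.exp (inner ℝ (∑ i, χ i • b i) (θ k)) ≤
        ∑ k, bfTerm (bfSpan b (A.erase p)) (b p) (θ k) (z p) (inner ℝ (∑ i, z i • b i) (θ k))) := by
  intro N
  induction N with
  | zero =>
    intro A hA
    have hA : A = ∅ := Finset.card_eq_zero.mp hA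
    subst hA
    refine ⟨?_, by simp⟩
    intro z hz hz1
    refine ⟨z, fun i => hz1 i (by simp), ?_⟩
    apply Finset.sum_le_sum
    intro k _
    apply Real.exp_le_exp.mpr
    have : 0 ≤ ‖(bfSpan b ∅).starProjection (θ k)‖ ^ 2 := sq_nonneg _
    linarith
  | succ N ih =>
    intro A hA
    have Q : ∀ p ∈ A, ∀ z : V → ℝ, (∀ i, |z i| ≤ 1) → (∀ i, i ∉ A → z i = 1 ∨ z i = -1) →
      ∃ χ : V → ℝ, (∀ i, χ i = 1 ∨ χ i = -1) ∧
        ∑ k, Real.exp (inner ℝ (∑ i, χ i • b i) (θ k)) ≤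
        ∑ k, bfTerm (bfSpan b (A.erase p)) (b p) (θ k) (z p)
          (inner ℝ (∑ i, z i • b i) (θ k)) := by
      intro p hp z hz hz1
      obtain ⟨u, hup, huA, hur⟩ := bf_dir b A p hp
      set U := bfSpan b (A.erase p) with hU
      set r := b p - U.starProjection (b p) with hr
      -- affine dependence
      have haff : ∀ δ : ℝ, ∑ k, bfTerm U (b p) (θ k) (z p + δ)
            (inner ℝ (∑ i, (z i + δ * u i) • b i) (θ k)) =
          ∑ k, bfTerm U (b p) (θ k) (z p) (inner ℝ (∑ i, z i • b i) (θ k)) +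
          δ * ∑ k, Real.exp (inner ℝ (∑ i, z i • b i) (θ k) - z p * inner ℝ r (θ k)
            + 4 * bfPot U (b p) (θ k)) * Real.sinh (inner ℝ r (θ k)) := by
        intro δ
        rw [Finset.mul_sum, ← Finset.sum_add_distrib]
        apply Finset.sum_congr rfl
        intro k _
        have e1 : ∑ i, (z i + δ * u i) • b i = ∑ i, z i • b i + δ • r := by
          rw [← hur, Finset.smul_sum, ← Finset.sum_add_distrib]
          apply Finset.sum_congr rfl
          intro i _
          rw [add_smul, mul_smul]
        rw [e1, inner_add_left, real_inner_smul_left]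
        unfold bfTerm
        rw [← hr]
        have e2 : inner ℝ (∑ i, z i • b i) (θ k) + δ * inner ℝ r (θ k)
            - (z p + δ) * inner ℝ r (θ k) = inner ℝ (∑ i, z i • b i) (θ k)
            - z p * inner ℝ r (θ k) := by ring
        rw [e2]; ring
      have hδ : ∃ δ : ℝ, (∀ i, |z i + δ * u i| ≤ 1) ∧
          (∃ j ∈ A, (z j + δ * u j = 1 ∨ z j + δ * u j = -1)) ∧
          ∑ k, bfTerm U (b p) (θ k) (z p + δ)
            (inner ℝ (∑ i, (z i + δ * u i) • b i) (θ k)) ≤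
          ∑ k, bfTerm U (b p) (θ k) (z p) (inner ℝ (∑ i, z i • b i) (θ k)) := by
        set s := ∑ k, Real.exp (inner ℝ (∑ i, z i • b i) (θ k) - z p * inner ℝ r (θ k)
            + 4 * bfPot U (b p) (θ k)) * Real.sinh (inner ℝ r (θ k)) with hs
        rcases le_total s 0 with h | h
        · obtain ⟨δ, h0, h1, h2⟩ := bf_move A z u p hp (by rw [hup]; norm_num) (fun i _ => hz i)
          refine ⟨δ, ?_, h2, ?_⟩
          · intro i
            by_cases hi : i ∈ A
            · exact h1 i hi
            · rw [huA i hi]; simpa using hz i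
          · rw [haff]; nlinarith
        · obtain ⟨δ, h0, h1, h2⟩ := bf_move A z (fun i => - u i) p hp (by rw [hup]; norm_num)
            (fun i _ => hz i)
          have e : ∀ i, δ * -u i = (-δ) * u i := fun i => by ring
          simp only [e] at h1 h2
          refine ⟨-δ, ?_, h2, ?_⟩
          · intro i
            by_cases hi : i ∈ A
            · exact h1 i hi
            · rw [huA i hi]; simpa using hz i
          · rw [haff]; nlinarith
      obtain ⟨δ, hd1, ⟨j, hjA, hj⟩, hle⟩ := hδ
      have hcard : (A.erase j).card = N := by rw [Finset.card_erase_of_mem hjA, hA]; rfl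
      have hoff : ∀ i, i ∉ A.erase j → z i + δ * u i = 1 ∨ z i + δ * u i = -1 := by
        intro i hi
        by_cases hij : i = j
        · subst hij; exact hj
        · have hiA : i ∉ A := fun h => hi (Finset.mem_erase.mpr ⟨hij, h⟩)
          rw [huA i hiA]; simpa using hz1 i hiA
      obtain ⟨ihP, ihQ⟩ := ih (A.erase j) hcard
      have ezp : z p + δ * u p = z p + δ := by rw [hup, mul_one]
      by_cases hjp : j = p
      · subst hjp
        obtain ⟨χ, hχ, hχ2⟩ := ihP (fun i => z i + δ * u i) hd1 hoff
        refine ⟨χ, hχ, hχ2.trans (le_trans (Finset.sum_le_sum fun k _ => ?_) hle)⟩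
        exact bfTerm_end _ _ _ (hb j) _ _ (by rw [← ezp]; exact hj)
      · obtain ⟨χ, hχ, hχ2⟩ := ihQ p (Finset.mem_erase.mpr ⟨Ne.symm hjp, hp⟩)
          (fun i => z i + δ * u i) hd1 hoff
        refine ⟨χ, hχ, hχ2.trans (le_trans (Finset.sum_le_sum fun k _ => ?_) hle)⟩
        simp only [ezp]
        apply bfTerm_upd _ _ _ _ _ (hb p) _ _ (by rw [← ezp]; exact hd1 p)
        exact bfSpan_mono b (Finset.erase_subset_erase _ (Finset.erase_subset _ _))
    refine ⟨?_, Q⟩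
    intro z hz hz1
    obtain ⟨p, hp⟩ : A.Nonempty := Finset.card_pos.mp (by omega)
    obtain ⟨χ, hχ, hχ2⟩ := Q p hp z hz hz1
    refine ⟨χ, hχ, hχ2.trans (Finset.sum_le_sum fun k _ => ?_)⟩
    apply bfTerm_start _ _ _ _ (bfSpan_mono b (Finset.erase_subset _ _)) _ _ _ (hz p)
    exact Submodule.subset_span ⟨p, by simpa using hp, rfl⟩

theorem bf_subgauss (b : V → E) (hb : ∀ i, ‖b i‖ ≤ 1) (θ : κ → E) :
    ∃ χ : V → ℝ, (∀ i, χ i = 1 ∨ χ i = -1) ∧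
        ∑ k, Real.exp (inner ℝ (∑ i, χ i • b i) (θ k)) ≤ ∑ k, Real.exp (4 * ‖θ k‖ ^ 2) := by
  obtain ⟨χ, hχ, h⟩ := (bf_main b hb θ _ Finset.univ rfl).1 (fun _ => 0) (by simp) (by simp)
  refine ⟨χ, hχ, h.trans (Finset.sum_le_sum fun k _ => ?_)⟩
  simp only [zero_smul, Finset.sum_const_zero, inner_zero_left, zero_add]
  gcongr
  exact Submodule.norm_starProjection_apply_le _ _
end

/-- Beck–Fiala with Banaszczyk's bound: there is a universal constant `C > 0`
such that any set system on `{1,…,n}` (`n ≥ 2`) in which every element lies in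
at most `t` sets (`t ≥ 1`) admits a `±1`-coloring of discrepancy at most
`C * √(t * log n)`. -/
theorem beck_fiala_banaszczyk :
    ∃ C : ℝ, 0 < C ∧
      ∀ (n t : ℕ), 2 ≤ n → 1 ≤ t →
        ∀ (m : ℕ) (S : Fin m → Finset (Fin n)),
          (∀ i : Fin n, (Finset.univ.filter fun j => i ∈ S j).card ≤ t) →
          ∃ χ : Fin n → ℝ, (∀ i, χ i = 1 ∨ χ i = -1) ∧
            ∀ j : Fin m, |∑ i ∈ S j, χ i| ≤ C * Real.sqrt (t * Real.log n) := by
  refine ⟨8, by norm_num, ?_⟩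
  intro n t hn ht m S hdeg
  have hn' : (2:ℝ) ≤ n := by exact_mod_cast hn
  have ht' : (1:ℝ) ≤ t := by exact_mod_cast ht
  have hlog2 : Real.log 2 ≤ Real.log n := Real.log_le_log (by norm_num) hn'
  have hl2 := Real.log_two_gt_d9
  have hlogpos : 0 < Real.log n := by linarith
  rcases le_total (n ^ 2) t with hcase | hcase
  · refine ⟨fun _ => 1, fun _ => Or.inl rfl, fun j => ?_⟩
    have h1 : |∑ i ∈ S j, (1:ℝ)| ≤ n := by
      simp only [Finset.sum_const, nsmul_eq_mul, mul_one, Nat.abs_cast]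
      exact_mod_cast (Finset.card_le_univ _).trans (by simp)
    refine h1.trans ?_
    have hc : (n:ℝ) ^ 2 ≤ t := by exact_mod_cast hcase
    have : (n:ℝ) / 8 ≤ Real.sqrt (t * Real.log n) := by
      apply Real.le_sqrt_of_sq_le
      nlinarith
    linarith
  · set J := Finset.univ.filter fun j : Fin m => (S j).Nonempty with hJ
    have hJcard : J.card ≤ n * t := by
      have hsub : J ⊆ Finset.univ.biUnion fun i : Fin n => Finset.univ.filter fun j => i ∈ S j := by
        intro j hj
        simp only [hJ, Finset.mem_filter, Finset.mem_univ, true_and] at hj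
        obtain ⟨i, hi⟩ := hj
        simp only [Finset.mem_biUnion, Finset.mem_filter, Finset.mem_univ, true_and]
        exact ⟨i, hi⟩
      refine (Finset.card_le_card hsub).trans ?_
      refine (Finset.card_biUnion_le_card_mul _ _ t fun i _ => hdeg i).trans ?_
      simp
    have hJ3 : (2 * J.card : ℝ) ≤ (n:ℝ) ^ 4 := by
      have h1 : J.card ≤ n * n ^ 2 := hJcard.trans (Nat.mul_le_mul_left _ hcase)
      have h2 : (J.card : ℝ) ≤ (n:ℝ) * (n:ℝ) ^ 2 := by exact_mod_cast h1
      have : (0:ℝ) ≤ (n:ℝ) ^ 3 := by positivity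
      nlinarith
    set lam := Real.sqrt (Real.log n) with hlam
    have hlampos : 0 < lam := Real.sqrt_pos.mpr hlogpos
    have hlamsq : lam ^ 2 = Real.log n := Real.sq_sqrt hlogpos.le
    have hst : 0 < Real.sqrt t := Real.sqrt_pos.mpr (by linarith)
    let b : Fin n → EuclideanSpace ℝ (Fin m) := fun i =>
      WithLp.toLp 2 fun j => if i ∈ S j then 1 / Real.sqrt t else 0
    have hb : ∀ i, ‖b i‖ ≤ 1 := by
      intro i
      rw [EuclideanSpace.norm_eq, Real.sqrt_le_one]
      have e : ∑ j, ‖b i j‖ ^ 2 = ((Finset.univ.filter fun j => i ∈ S j).card : ℝ) / t := by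
        have : ∀ j, ‖b i j‖ ^ 2 = if i ∈ S j then 1 / (t:ℝ) else 0 := by
          intro j
          simp only [b]
          split_ifs
          · rw [Real.norm_eq_abs, sq_abs, div_pow, Real.sq_sqrt (by linarith), one_pow]
          · simp
        simp only [this]
        rw [← Finset.sum_filter, Finset.sum_const, nsmul_eq_mul]; ring
      rw [e, div_le_one (by linarith)]
      exact_mod_cast hdeg i
    let θ : J × Bool → EuclideanSpace ℝ (Fin m) := fun k =>
      EuclideanSpace.single k.1.1 (if k.2 then lam else -lam)
    obtain ⟨χ, hχ, hsum⟩ := bf_subgauss b hb θ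
    refine ⟨χ, hχ, fun j => ?_⟩
    by_cases hj : (S j).Nonempty
    swap
    · rw [Finset.not_nonempty_iff_eq_empty.mp hj]
      simp only [Finset.sum_empty, abs_zero]
      positivity
    have hjJ : j ∈ J := by simp [hJ, hj]
    have hnorm : ∀ k, ‖θ k‖ ^ 2 = Real.log n := by
      intro k
      simp only [θ, EuclideanSpace.norm_single]
      rw [Real.norm_eq_abs, sq_abs, ← hlamsq]
      split_ifs <;> ring
    have hrhs : ∑ k, Real.exp (4 * ‖θ k‖ ^ 2) ≤ Real.exp (8 * Real.log n) := by
      simp only [hnorm]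
      rw [Finset.sum_const, nsmul_eq_mul, Finset.card_univ, Fintype.card_prod, Fintype.card_bool,
        Fintype.card_coe]
      have e4 : Real.exp (4 * Real.log n) = (n:ℝ) ^ 4 := by
        rw [mul_comm, Real.exp_mul, Real.exp_log (by linarith)]
        norm_cast
      have e8 : Real.exp (8 * Real.log n) = (n:ℝ) ^ 4 * Real.exp (4 * Real.log n) := by
        rw [← e4, ← Real.exp_add]; ring_nf
      rw [e8]
      gcongr
      push_cast
      linarith
    have hX : ∀ c : Bool, inner ℝ (∑ i, χ i • b i) (θ (⟨j, hjJ⟩, c)) =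
        (if c then lam else -lam) * ((∑ i ∈ S j, χ i) / Real.sqrt t) := by
      intro c
      simp only [θ, EuclideanSpace.inner_single_right]
      have : (∑ i, χ i • b i) j = (∑ i ∈ S j, χ i) / Real.sqrt t := by
        simp only [WithLp.ofLp_sum, Finset.sum_apply, WithLp.ofLp_smul, Pi.smul_apply, b, smul_eq_mul,
          mul_ite, mul_zero]
        rw [← Finset.sum_filter, Finset.sum_div]
        simp [div_eq_mul_inv]
      rw [this]; simp
    have hbound : ∀ c : Bool, (if c then lam else -lam) * ((∑ i ∈ S j, χ i) / Real.sqrt t) ≤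
        8 * Real.log n := by
      intro c
      rw [← hX c]
      apply Real.exp_le_exp.mp
      refine le_trans ?_ (hsum.trans hrhs)
      exact Finset.single_le_sum (f := fun k => Real.exp (inner ℝ (∑ i, χ i • b i) (θ k)))
        (fun k _ => (Real.exp_pos _).le) (Finset.mem_univ ((⟨j, hjJ⟩, c) : J × Bool))
    have h1 := hbound true
    have h2 := hbound false
    simp only [if_true, Bool.false_eq_true, if_false] at h1 h2
    rw [Real.sqrt_mul (by linarith), ← hlam]
    have hY : |(∑ i ∈ S j, χ i) / Real.sqrt t| ≤ 8 * lam := by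
      rw [← hlamsq] at h1 h2
      rw [abs_le]
      constructor
      · refine le_of_mul_le_mul_left ?_ hlampos
        nlinarith
      · refine le_of_mul_le_mul_left ?_ hlampos
        nlinarith
    rw [abs_div, abs_of_pos hst, div_le_iff₀ hst] at hY
    linarith
end

section
/- There exists a universal constant C > 0 such that the following holds. Let n ≥ 2 and m ≥ 1 be integers, and let A be a real m×n matrix each of whose columns has Euclidean (ℓ2) norm at most 1. Then there exists a vector x ∈ {-1,1}^n such that ‖Ax‖_∞ ≤ C·√(log n). -/
namespace Komlos

/-- log of the pivot potential -/
noncomputable def g (x a s k : ℝ) : ℝ :=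
  min (25 * k + 2 * k * (1 - x ^ 2)) (-(a * x) + k / 2 + 1 - s / 2)

lemma g_step {x a s k e a' s' k' e' : ℝ} (hx : |x| ≤ 1) (hk : k' + e' ≤ k + e) (he : e' ≤ e)
    (hd : (a' - a) ^ 2 ≤ (s' - s) * (e - e')) (hs : s ≤ s') :
    g x a' s' k' + 27 * e' ≤ g x a s k + 27 * e := by
  have hx2 : x ^ 2 ≤ 1 := by rw [sq_le_one_iff_abs_le_one]; exact hx
  have h1 : |a' - a| ≤ (s' - s) / 2 + (e - e') / 2 := by
    apply abs_le_of_sq_le_sq _ (by linarith)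
    nlinarith [sq_nonneg ((s' - s) - (e - e'))]
  have h2 : -(a' * x) + a * x ≤ |a' - a| := by
    have : -(a' * x) + a * x = -((a' - a) * x) := by ring
    rw [this]
    calc _ ≤ |(a' - a) * x| := neg_le_abs _
      _ = |a' - a| * |x| := abs_mul _ _
      _ ≤ |a' - a| * 1 := by gcongr
      _ = _ := mul_one _
  unfold g
  rw [← min_add_add_right, ← min_add_add_right]
  apply min_le_min
  · nlinarith [mul_nonneg (sub_nonneg.2 hx2) (sub_nonneg.2 hk), mul_nonneg (sq_nonneg x) (sub_nonneg.2 he)]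
  · linarith

lemma g_nonneg {x a s k : ℝ} (hx : |x| = 1) (hk : a ^ 2 ≤ k) (hs : s ≤ 1) : 0 ≤ g x a s k := by
  have hx2 : x ^ 2 = 1 := by rw [← sq_abs, hx]; norm_num
  have hk0 : 0 ≤ k := (sq_nonneg a).trans hk
  unfold g
  apply le_min
  · rw [hx2]; linarith
  · nlinarith [sq_nonneg (a - x)]

lemma g_le {x a s k : ℝ} (hk : 0 ≤ k) : g x a s k ≤ 27 * k := by
  unfold g
  apply (min_le_left _ _).trans
  nlinarith [mul_nonneg hk (sq_nonneg x)]

lemma conc_gauss {a k c : ℝ} (hk : a ^ 2 ≤ k) (hk1 : k ≤ 1 / 16) :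
    ConcaveOn ℝ (Set.Icc (-1) 1) (fun y => Real.exp (c + a * y + 2 * k * (1 - y ^ 2))) := by
  have hk0 : 0 ≤ k := (sq_nonneg a).trans hk
  have hd : ∀ y, HasDerivAt (fun y => Real.exp (c + a * y + 2 * k * (1 - y ^ 2)))
      (Real.exp (c + a * y + 2 * k * (1 - y ^ 2)) * (a - 4 * k * y)) y := by
    intro y
    apply HasDerivAt.exp
    have := (((hasDerivAt_id y).const_mul a).const_add c).add
      ((((hasDerivAt_id y).pow 2).const_sub 1).const_mul (2 * k))
    refine this.congr_deriv ?_
    simp; ring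
  have hd2 : ∀ y, HasDerivAt (fun y => Real.exp (c + a * y + 2 * k * (1 - y ^ 2)) * (a - 4 * k * y))
      (Real.exp (c + a * y + 2 * k * (1 - y ^ 2)) * ((a - 4 * k * y) ^ 2 - 4 * k)) y := by
    intro y
    have := (hd y).mul (((hasDerivAt_id y).const_mul (4 * k)).const_sub a)
    refine this.congr_deriv ?_
    simp; ring
  have e1 : deriv (fun y => Real.exp (c + a * y + 2 * k * (1 - y ^ 2))) =
      (fun y => Real.exp (c + a * y + 2 * k * (1 - y ^ 2)) * (a - 4 * k * y)) :=
    funext fun y => (hd y).deriv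
  apply concaveOn_of_deriv2_nonpos (convex_Icc _ _)
  · exact fun y _ => (hd y).continuousAt.continuousWithinAt
  · exact fun y _ => (hd y).differentiableAt.differentiableWithinAt
  · rw [e1]; exact fun y _ => (hd2 y).differentiableAt.differentiableWithinAt
  · intro y hy
    rw [interior_Icc] at hy
    simp only [Function.iterate_succ, Function.iterate_zero, Function.comp, id]
    rw [e1, (hd2 y).deriv]
    apply mul_nonpos_of_nonneg_of_nonpos (Real.exp_pos _).le
    have hy2 : y ^ 2 ≤ 1 := by nlinarith [hy.1, hy.2]
    have : (a - 4 * k * y) ^ 2 ≤ 2 * (a ^ 2 + 16 * k ^ 2 * y ^ 2) := by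
      nlinarith [sq_nonneg (a + 4 * k * y)]
    have h3 : k ^ 2 * y ^ 2 ≤ k ^ 2 := by nlinarith [sq_nonneg k]
    nlinarith

lemma g_conc {a s k c : ℝ} (hk : a ^ 2 ≤ k) (hs0 : 0 ≤ s) :
    ConcaveOn ℝ (Set.Icc (-1) 1) (fun y => Real.exp (c + a * y + g y a s k)) := by
  have hk0 : 0 ≤ k := (sq_nonneg a).trans hk
  rcases le_total k (1 / 16) with h | h
  · have h1 := conc_gauss (c := c + 25 * k) hk h
    have h2 : ConcaveOn ℝ (Set.Icc (-1) 1) (fun _ : ℝ => Real.exp (c + (k / 2 + 1 - s / 2))) :=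
      concaveOn_const _ (convex_Icc _ _)
    refine (h1.inf h2).congr ?_
    intro y _
    simp only [g, Pi.inf_apply]
    rw [← min_add_add_left, Real.exp_monotone.map_min]
    congr 2 <;> ring
  · have h2 : ConcaveOn ℝ (Set.Icc (-1) 1) (fun _ : ℝ => Real.exp (c + (k / 2 + 1 - s / 2))) :=
      concaveOn_const _ (convex_Icc _ _)
    apply h2.congr
    intro y hy
    have hy2 : y ^ 2 ≤ 1 := by nlinarith [hy.1, hy.2]
    have : g y a s k = -(a * y) + k / 2 + 1 - s / 2 := by
      apply min_eq_right
      nlinarith [mul_nonneg hk0 (sub_nonneg.2 hy2), sq_nonneg (4 * a + y)]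
    simp only [this]
    congr 1; ring

section proj
variable {E : Type*} [NormedAddCommGroup E] [InnerProductSpace ℝ E] [FiniteDimensional ℝ E]

lemma proj_norm_sub {U V : Submodule ℝ E} (h : U ≤ V) (v : E) :
    ‖V.starProjection v - U.starProjection v‖ ^ 2 =
      ‖V.starProjection v‖ ^ 2 - ‖U.starProjection v‖ ^ 2 := by
  have h1 : inner ℝ (V.starProjection v - U.starProjection v) (U.starProjection v) = 0 := by
    have a1 := V.starProjection_inner_eq_zero v (U.starProjection v)
      (h (U.starProjection_apply_mem v))
    have a2 := U.starProjection_inner_eq_zero v (U.starProjection v) (U.starProjection_apply_mem v)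
    rw [inner_sub_left] at *
    linarith
  have h2 : V.starProjection v = (V.starProjection v - U.starProjection v) + U.starProjection v := by
    abel
  have h3 := norm_add_sq_real (V.starProjection v - U.starProjection v) (U.starProjection v)
  rw [← h2, h1] at h3
  linarith

lemma proj_mono {U V : Submodule ℝ E} (h : U ≤ V) (v : E) :
    ‖U.starProjection v‖ ^ 2 ≤ ‖V.starProjection v‖ ^ 2 := by
  have := proj_norm_sub h v
  nlinarith [sq_nonneg ‖V.starProjection v - U.starProjection v‖]

lemma proj_cs {U V : Submodule ℝ E} (h : U ≤ V) (v t : E) :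
    (inner ℝ (V.starProjection v - U.starProjection v) t) ^ 2 ≤
      (‖V.starProjection v‖ ^ 2 - ‖U.starProjection v‖ ^ 2) *
      (‖V.starProjection t‖ ^ 2 - ‖U.starProjection t‖ ^ 2) := by
  rw [← proj_norm_sub h, ← proj_norm_sub h, ← mul_pow]
  have : inner ℝ (V.starProjection v - U.starProjection v) t =
      inner ℝ (V.starProjection v - U.starProjection v) (V.starProjection t - U.starProjection t) := by
    have hm : V.starProjection v - U.starProjection v ∈ V :=
      V.sub_mem (V.starProjection_apply_mem v) (h (U.starProjection_apply_mem v))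
    have b1 := V.starProjection_inner_eq_zero t _ hm
    have b2 : inner ℝ (V.starProjection v - U.starProjection v) (U.starProjection t) = 0 := by
      have a1 := V.starProjection_inner_eq_zero v (U.starProjection t)
        (h (U.starProjection_apply_mem t))
      have a2 := U.starProjection_inner_eq_zero v (U.starProjection t)
        (U.starProjection_apply_mem t)
      rw [inner_sub_left] at *
      linarith
    rw [real_inner_comm, inner_sub_right] at b1
    rw [inner_sub_right, b2]
    linarith
  rw [this]
  apply sq_le_sq'
  · have := abs_real_inner_le_norm (V.starProjection v - U.starProjection v)
      (V.starProjection t - U.starProjection t)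
    exact (abs_le.1 this).1
  · exact real_inner_le_norm _ _

end proj

lemma exists_step {n : ℕ} (S : Finset (Fin n)) (X u : Fin n → ℝ) (p : Fin n) (hp : p ∈ S)
    (hu : 1 ≤ |u p|) (hX : ∀ i, |X i| ≤ 1) :
    ∃ d : ℝ, 0 ≤ d ∧ (∀ i ∈ S, |X i + d * u i| ≤ 1) ∧ ∃ i ∈ S, |X i + d * u i| = 1 := by
  have hne : S.Nonempty := ⟨p, hp⟩
  let f : ℝ → ℝ := fun d => S.sup' hne (fun i => |X i + d * u i|)
  have hf : Continuous f := by
    apply Continuous.finset_sup'_apply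
    intro i _
    fun_prop
  have h0 : f 0 ≤ 1 := by
    apply Finset.sup'_le
    intro i _
    simpa using hX i
  have h2 : 1 ≤ f 2 := by
    refine le_trans ?_ (Finset.le_sup' (fun i => |X i + 2 * u i|) hp)
    have h := abs_sub_abs_le_abs_sub (2 * u p) (-(X p))
    rw [abs_neg, abs_mul, abs_two] at h
    have := hX p
    have e : 2 * u p - -X p = X p + 2 * u p := by ring
    rw [e] at h
    linarith
  obtain ⟨d, hd, hd1⟩ := intermediate_value_Icc (by norm_num : (0:ℝ) ≤ 2) hf.continuousOn ⟨h0, h2⟩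
  refine ⟨d, hd.1, fun i hi => ?_, ?_⟩
  · rw [← hd1]
    exact Finset.le_sup' (fun i => |X i + d * u i|) hi
  · obtain ⟨i, hi, h⟩ := Finset.exists_mem_eq_sup' hne (fun i => |X i + d * u i|)
    exact ⟨i, hi, by rw [← h]; exact hd1⟩

lemma conc_sum {ι : Type*} (T : Finset ι) (f : ι → ℝ → ℝ) {D : Set ℝ} (hD : Convex ℝ D)
    (h : ∀ t ∈ T, ConcaveOn ℝ D (f t)) : ConcaveOn ℝ D (fun y => ∑ t ∈ T, f t y) := by
  classical
  induction T using Finset.induction_on with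
  | empty => simpa using concaveOn_const 0 hD
  | insert t T ht ih =>
    simp only [Finset.sum_insert ht]
    exact (h t (Finset.mem_insert_self _ _)).add
      (ih fun t' ht' => h t' (Finset.mem_insert_of_mem ht'))

section main
variable {E : Type*} [NormedAddCommGroup E] [InnerProductSpace ℝ E] [FiniteDimensional ℝ E]
variable {n : ℕ}

/-- span of the vectors indexed by `S` -/
def sp (v : Fin n → E) (S : Finset (Fin n)) : Submodule ℝ E :=
  Submodule.span ℝ (v '' (S : Set (Fin n)))

lemma sp_mono (v : Fin n → E) {S S' : Finset (Fin n)} (h : S ⊆ S') : sp v S ≤ sp v S' :=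
  Submodule.span_mono (Set.image_mono (by exact_mod_cast h))

/-- energy -/
noncomputable def en (v : Fin n → E) (S : Finset (Fin n)) (t : E) : ℝ :=
  ‖(sp v S).starProjection t‖ ^ 2

/-- the residual of the pivot -/
noncomputable def res (v : Fin n → E) (S : Finset (Fin n)) (p : Fin n) : E :=
  v p - (sp v (S.erase p)).starProjection (v p)

/-- the log potential of one test vector -/
noncomputable def pot (v : Fin n → E) (S : Finset (Fin n)) (p : Fin n) (x : ℝ) (t : E) : ℝ :=
  g x (inner ℝ (res v S p) t) (‖v p‖ ^ 2 - en v (S.erase p) (v p))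
    (en v S t - en v (S.erase p) t) + 27 * en v (S.erase p) t

lemma en_mono (v : Fin n → E) {S S' : Finset (Fin n)} (h : S ⊆ S') (t : E) :
    en v S t ≤ en v S' t := proj_mono (sp_mono v h) t

lemma en_le (v : Fin n → E) (S : Finset (Fin n)) (t : E) : en v S t ≤ ‖t‖ ^ 2 := by
  unfold en
  gcongr
  exact Submodule.norm_starProjection_apply_le _ _

lemma res_sq (v : Fin n → E) (hv : ∀ i, ‖v i‖ ≤ 1) {S : Finset (Fin n)} {p : Fin n} (hp : p ∈ S)
    (t : E) : (inner ℝ (res v S p) t) ^ 2 ≤ en v S t - en v (S.erase p) t := by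
  have h := proj_cs (sp_mono v (S.erase_subset p)) (v p) t
  have hm : v p ∈ sp v S := Submodule.subset_span ⟨p, by exact_mod_cast hp, rfl⟩
  rw [Submodule.starProjection_eq_self_iff.2 hm] at h
  refine h.trans ?_
  have h1 : ‖v p‖ ^ 2 ≤ 1 := pow_le_one₀ (norm_nonneg _) (hv p)
  have h2 : 0 ≤ en v S t - en v (S.erase p) t := sub_nonneg.2 (en_mono v (S.erase_subset p) t)
  have h3 : ‖v p‖ ^ 2 - ‖(sp v (S.erase p)).starProjection (v p)‖ ^ 2 ≤ 1 := by
    nlinarith [sq_nonneg ‖(sp v (S.erase p)).starProjection (v p)‖]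
  calc _ ≤ 1 * (en v S t - en v (S.erase p) t) := mul_le_mul_of_nonneg_right h3 h2
    _ = _ := one_mul _

lemma pot_le (v : Fin n → E) (S : Finset (Fin n)) (p : Fin n) (x : ℝ) (t : E) :
    pot v S p x t ≤ 27 * en v S t := by
  have h2 : 0 ≤ en v S t - en v (S.erase p) t := sub_nonneg.2 (en_mono v (S.erase_subset p) t)
  have := g_le (x := x) (a := inner ℝ (res v S p) t)
    (s := ‖v p‖ ^ 2 - en v (S.erase p) (v p)) h2
  unfold pot
  linarith

lemma le_pot (v : Fin n → E) (hv : ∀ i, ‖v i‖ ≤ 1) {S : Finset (Fin n)} {p : Fin n} (hp : p ∈ S)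
    {x : ℝ} (hx : |x| = 1) (t : E) : 27 * en v (S.erase p) t ≤ pot v S p x t := by
  have h1 : ‖v p‖ ^ 2 ≤ 1 := pow_le_one₀ (norm_nonneg _) (hv p)
  have h3 : ‖v p‖ ^ 2 - en v (S.erase p) (v p) ≤ 1 := by
    have : 0 ≤ en v (S.erase p) (v p) := sq_nonneg _
    linarith
  have := g_nonneg hx (res_sq v hv hp t) h3
  unfold pot
  linarith

lemma pot_step (v : Fin n → E) {S : Finset (Fin n)} {p i : Fin n}
    {x : ℝ} (hx : |x| ≤ 1) (t : E) : pot v (S.erase i) p x t ≤ pot v S p x t := by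
  have hsub : (S.erase i).erase p ⊆ S.erase p := Finset.erase_subset_erase _ (S.erase_subset i)
  have e1 := en_mono v hsub t
  have e2 := en_mono v hsub (v p)
  have e3 := en_mono v (S.erase_subset i) t
  apply g_step hx
  · linarith
  · exact e1
  · have := proj_cs (sp_mono v hsub) (v p) t
    have e : inner ℝ (res v (S.erase i) p) t - inner ℝ (res v S p) t =
      inner ℝ ((sp v (S.erase p)).starProjection (v p) -
        (sp v ((S.erase i).erase p)).starProjection (v p)) t := by
      rw [← inner_sub_left]
      congr 1
      unfold res
      abel
    rw [e]
    refine this.trans (le_of_eq ?_)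
    unfold en
    ring
  · linarith

lemma exists_dir (v : Fin n → E) {S : Finset (Fin n)} {p : Fin n} (hp : p ∈ S) :
    ∃ u : Fin n → ℝ, u p = 1 ∧ (∀ i, i ∉ S → u i = 0) ∧ ∑ i, u i • v i = res v S p := by
  classical
  have hm := (sp v (S.erase p)).starProjection_apply_mem (v p)
  unfold sp at hm
  rw [Submodule.mem_span_image_finset_iff_exists_fun'] at hm
  obtain ⟨c, hc⟩ := hm
  refine ⟨fun i => if i = p then 1 else if i ∈ S then - c i else 0, by simp, ?_, ?_⟩
  · intro i hi
    have : i ≠ p := fun h => hi (h ▸ hp)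
    simp [this, hi]
  · rw [← Finset.add_sum_erase _ _ (Finset.mem_univ p)]
    unfold res sp
    rw [← hc, sub_eq_add_neg, ← Finset.sum_neg_distrib]
    simp only [if_true, one_smul]
    congr 1
    symm
    apply Finset.sum_subset_zero_on_sdiff
    · exact Finset.erase_subset_erase _ (Finset.subset_univ _)
    · intro i hi
      simp only [Finset.mem_sdiff, Finset.mem_erase, Finset.mem_univ, and_true] at hi
      have : i ∉ S := fun h => hi.2 ⟨hi.1, h⟩
      simp [this, hi.1]
    · intro i hi
      rw [Finset.mem_erase] at hi
      simp [hi.1, hi.2]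

lemma walk {ι : Type*} (T : Finset ι) (θ : ι → E) (v : Fin n → E) (hv : ∀ i, ‖v i‖ ≤ 1)
    (S : Finset (Fin n)) :
    (∀ X : Fin n → ℝ, (∀ i, |X i| ≤ 1) → (∀ i, i ∉ S → |X i| = 1) →
      ∃ Y : Fin n → ℝ, (∀ i, |Y i| = 1) ∧
        ∑ t ∈ T, Real.exp (inner ℝ (∑ i, Y i • v i) (θ t)) ≤
        ∑ t ∈ T, Real.exp (inner ℝ (∑ i, X i • v i) (θ t) + 27 * en v S (θ t))) ∧
    (∀ p ∈ S, ∀ X : Fin n → ℝ, (∀ i, |X i| ≤ 1) → (∀ i, i ∉ S → |X i| = 1) →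
      ∃ Y : Fin n → ℝ, (∀ i, |Y i| = 1) ∧
        ∑ t ∈ T, Real.exp (inner ℝ (∑ i, Y i • v i) (θ t)) ≤
        ∑ t ∈ T, Real.exp (inner ℝ (∑ i, X i • v i) (θ t) + pot v S p (X p) (θ t))) := by
  induction S using Finset.strongInduction with
  | H S ih =>
  have B : (∀ p ∈ S, ∀ X : Fin n → ℝ, (∀ i, |X i| ≤ 1) → (∀ i, i ∉ S → |X i| = 1) →
      ∃ Y : Fin n → ℝ, (∀ i, |Y i| = 1) ∧
        ∑ t ∈ T, Real.exp (inner ℝ (∑ i, Y i • v i) (θ t)) ≤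
        ∑ t ∈ T, Real.exp (inner ℝ (∑ i, X i • v i) (θ t) + pot v S p (X p) (θ t))) := by
    intro p hp X hX hXS
    -- a state with a newly frozen coordinate
    have key : ∀ X' : Fin n → ℝ, (∀ i, |X' i| ≤ 1) → (∀ i, i ∉ S → |X' i| = 1) →
        (∃ i ∈ S, |X' i| = 1) → ∃ Y : Fin n → ℝ, (∀ i, |Y i| = 1) ∧
        ∑ t ∈ T, Real.exp (inner ℝ (∑ i, Y i • v i) (θ t)) ≤
        ∑ t ∈ T, Real.exp (inner ℝ (∑ i, X' i • v i) (θ t) + pot v S p (X' p) (θ t)) := by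
      rintro X' hX' hXS' ⟨i, hi, hi1⟩
      have hfr : ∀ j, j ∉ S.erase i → |X' j| = 1 := by
        intro j hj
        by_cases hji : j = i
        · rw [hji]; exact hi1
        · exact hXS' j fun h => hj (Finset.mem_erase.2 ⟨hji, h⟩)
      have IH := ih (S.erase i) (Finset.erase_ssubset hi)
      by_cases hip : i = p
      · subst hip
        obtain ⟨Y, hY, hle⟩ := IH.1 X' hX' hfr
        refine ⟨Y, hY, hle.trans ?_⟩
        gcongr with t ht
        exact le_pot v hv hp hi1 _
      · obtain ⟨Y, hY, hle⟩ := IH.2 p (Finset.mem_erase.2 ⟨fun h => hip h.symm, hp⟩) X' hX' hfr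
        refine ⟨Y, hY, hle.trans ?_⟩
        gcongr with t ht
        exact pot_step v (hX' p) _
    obtain ⟨u, hup, huS, hu⟩ := exists_dir v hp
    obtain ⟨d1, hd1, hc1, hf1⟩ := exists_step S X u p hp (by simp [hup]) hX
    obtain ⟨d2, hd2, hc2, hf2⟩ := exists_step S X (-u) p hp (by simp [hup]) hX
    let F : ℝ → ℝ := fun y => ∑ t ∈ T,
      Real.exp ((inner ℝ (∑ i, X i • v i) (θ t) - inner ℝ (res v S p) (θ t) * X p +
        27 * en v (S.erase p) (θ t)) + inner ℝ (res v S p) (θ t) * y +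
        g y (inner ℝ (res v S p) (θ t)) (‖v p‖ ^ 2 - en v (S.erase p) (v p))
          (en v S (θ t) - en v (S.erase p) (θ t)))
    have hF : ConcaveOn ℝ (Set.Icc (-1) 1) F := by
      apply conc_sum _ _ (convex_Icc _ _)
      intro t _
      apply g_conc (res_sq v hv hp _)
      exact sub_nonneg.2 (en_le v _ _)
    have hval : ∀ d : ℝ, F (X p + d) = ∑ t ∈ T, Real.exp
        (inner ℝ (∑ i, (X i + d * u i) • v i) (θ t) + pot v S p (X p + d * u p) (θ t)) := by
      intro d
      apply Finset.sum_congr rfl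
      intro t _
      congr 1
      simp only [add_smul, mul_smul, Finset.sum_add_distrib, ← Finset.smul_sum, hu,
        inner_add_left, real_inner_smul_left, hup, mul_one, pot]
      ring
    have hval0 := hval 0
    simp only [zero_mul, add_zero] at hval0
    have fin : ∀ d : ℝ, (∀ i ∈ S, |X i + d * u i| ≤ 1) → (∃ i ∈ S, |X i + d * u i| = 1) →
        F (X p + d) ≤ F (X p) → ∃ Y : Fin n → ℝ, (∀ i, |Y i| = 1) ∧
        ∑ t ∈ T, Real.exp (inner ℝ (∑ i, Y i • v i) (θ t)) ≤
        ∑ t ∈ T, Real.exp (inner ℝ (∑ i, X i • v i) (θ t) + pot v S p (X p) (θ t)) := by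
      intro d hc hf hle
      have h0 : ∀ i, i ∉ S → |X i + d * u i| = 1 := by
        intro i hi
        rw [huS i hi]; simpa using hXS i hi
      obtain ⟨Y, hY, hY2⟩ := key (fun i => X i + d * u i)
        (fun i => by
          by_cases hi : i ∈ S
          · exact hc i hi
          · exact (h0 i hi).le) h0 hf
      refine ⟨Y, hY, hY2.trans ?_⟩
      rw [← hval0]
      rw [← hval]
      exact hle
    have e2 : ∀ i, X i + d2 * (-u) i = X i + (-d2) * u i := by
      intro i; simp
    simp only [e2] at hc2 hf2
    have m1 := abs_le.1 (hc1 p hp)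
    have m2 := abs_le.1 (hc2 p hp)
    rw [hup, mul_one] at m1 m2
    have hmin := hF.min_le_of_mem_Icc (x := X p + -d2) (y := X p + d1) (z := X p) m2 m1
      ⟨by linarith, by linarith⟩
    rcases min_le_iff.1 hmin with h | h
    · exact fin _ hc2 hf2 h
    · exact fin _ hc1 hf1 h
  refine ⟨?_, B⟩
  intro X hX hXS
  rcases S.eq_empty_or_nonempty with h | ⟨p, hp⟩
  · refine ⟨X, fun i => hXS i (by simp [h]), ?_⟩
    gcongr with t ht
    have : 0 ≤ en v S (θ t) := sq_nonneg _
    linarith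
  · obtain ⟨Y, hY, hle⟩ := B p hp X hX hXS
    refine ⟨Y, hY, hle.trans ?_⟩
    gcongr with t ht
    exact pot_le v S p _ _

lemma subgauss {ι : Type*} (T : Finset ι) (θ : ι → E) (v : Fin n → E) (hv : ∀ i, ‖v i‖ ≤ 1) :
    ∃ Y : Fin n → ℝ, (∀ i, |Y i| = 1) ∧
        ∑ t ∈ T, Real.exp (inner ℝ (∑ i, Y i • v i) (θ t)) ≤
        ∑ t ∈ T, Real.exp (27 * ‖θ t‖ ^ 2) := by
  obtain ⟨Y, hY, h⟩ := (walk T θ v hv Finset.univ).1 0 (by simp) (by simp)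
  refine ⟨Y, hY, h.trans ?_⟩
  gcongr with t ht
  simp only [Pi.zero_apply, zero_smul, Finset.sum_const_zero, inner_zero_left, zero_add]
  have := en_le v Finset.univ (θ t)
  linarith

end main

end Komlos

/-- Komlós setting with Banaszczyk's bound: there is a universal constant `C > 0`
such that for any `m × n` real matrix (`n ≥ 2`, `m ≥ 1`) whose columns have
`ℓ₂`-norm at most `1`, there are signs `x ∈ {-1,1}ⁿ` with `‖Ax‖_∞ ≤ C * √(log n)`. -/
theorem komlos_banaszczyk :
    ∃ C : ℝ, 0 < C ∧
      ∀ (n m : ℕ), 2 ≤ n → 1 ≤ m →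
        ∀ A : Matrix (Fin m) (Fin n) ℝ,
          (∀ j : Fin n, ∑ i : Fin m, (A i j) ^ 2 ≤ 1) →
          ∃ x : Fin n → ℝ, (∀ j, x j = 1 ∨ x j = -1) ∧
            ∀ i : Fin m, |∑ j : Fin n, A i j * x j| ≤ C * Real.sqrt (Real.log n) := by
  classical
  refine ⟨30, by norm_num, ?_⟩
  intro n m hn _ A hA
  have hn' : (2 : ℝ) ≤ n := by exact_mod_cast hn
  have hlog2 : Real.log 2 ≤ Real.log n := Real.log_le_log (by norm_num) hn'
  have hl2 := Real.log_two_gt_d9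
  set l := Real.sqrt (Real.log n) with hl
  have hlsq : l ^ 2 = Real.log n := Real.sq_sqrt (by linarith)
  have hl0 : 0 ≤ l := Real.sqrt_nonneg _
  have hlpos : 0 < l := Real.sqrt_pos.2 (by linarith)
  let v : Fin n → EuclideanSpace ℝ (Fin m) := fun j => WithLp.toLp 2 (fun i => A i j)
  have hv : ∀ j, ‖v j‖ ≤ 1 := by
    intro j
    rw [EuclideanSpace.norm_eq, Real.sqrt_le_one]
    simpa [v] using hA j
  let J : Finset (Fin m) := Finset.univ.filter fun i => 1 < ∑ j, |A i j|
  have hJ : (J.card : ℝ) ≤ (n : ℝ) ^ 2 := by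
    have h1 : ∀ i ∈ J, (1 : ℝ) ≤ n * ∑ j, (A i j) ^ 2 := by
      intro i hi
      have hi' : 1 < ∑ j, |A i j| := (Finset.mem_filter.1 hi).2
      have := sq_sum_le_card_mul_sum_sq (s := (Finset.univ : Finset (Fin n))) (f := fun j => |A i j|)
      simp only [sq_abs, Finset.card_univ, Fintype.card_fin] at this
      nlinarith
    calc (J.card : ℝ) = ∑ i ∈ J, (1 : ℝ) := by simp
      _ ≤ ∑ i ∈ J, n * ∑ j, (A i j) ^ 2 := Finset.sum_le_sum h1
      _ ≤ ∑ i, n * ∑ j, (A i j) ^ 2 := by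
        apply Finset.sum_le_sum_of_subset_of_nonneg (Finset.subset_univ _)
        intro i _ _
        positivity
      _ = n * ∑ j, ∑ i, (A i j) ^ 2 := by rw [← Finset.mul_sum, Finset.sum_comm]
      _ ≤ n * ∑ j : Fin n, 1 := by gcongr with j; exact hA j
      _ = (n : ℝ) ^ 2 := by simp; ring
  let θ : Fin m × Bool → EuclideanSpace ℝ (Fin m) := fun t =>
    (if t.2 then l else -l) • EuclideanSpace.single t.1 (1 : ℝ)
  have hθ : ∀ t, ‖θ t‖ ^ 2 = l ^ 2 := by
    rintro ⟨i, b⟩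
    cases b <;> simp [θ, norm_smul]
  obtain ⟨Y, hY, hle⟩ := Komlos.subgauss (J ×ˢ (Finset.univ : Finset Bool)) θ v hv
  refine ⟨Y, fun j => eq_or_eq_neg_of_abs_eq (hY j), fun i => ?_⟩
  by_cases hi : 1 < ∑ j, |A i j|
  · have hiJ : i ∈ J := by simp [J, hi]
    have hin : ∀ b : Bool, inner ℝ (∑ j, Y j • v j) (θ (i, b)) =
        (if b then l else -l) * ∑ j, A i j * Y j := by
      intro b
      simp only [θ, inner_smul_right, EuclideanSpace.inner_single_right]
      simp [v, mul_comm]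
    have hb : ∀ b : Bool, (if b then l else -l) * ∑ j, A i j * Y j ≤ 30 * l ^ 2 := by
      intro b
      have h1 := Finset.single_le_sum (f := fun t => Real.exp (inner ℝ (∑ i, Y i • v i) (θ t)))
        (fun t _ => (Real.exp_pos _).le)
        (show (i, b) ∈ J ×ˢ (Finset.univ : Finset Bool) by simp [hiJ])
      have h2 := h1.trans hle
      simp only [hθ, hin] at h2
      rw [Finset.sum_const, Finset.card_product, nsmul_eq_mul] at h2
      simp only [Finset.card_univ, Fintype.card_bool] at h2
      have h3 : ((J.card * 2 : ℕ) : ℝ) ≤ Real.exp (3 * l ^ 2) := by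
        have : Real.exp (3 * l ^ 2) = (n : ℝ) ^ 3 := by
          rw [hlsq, mul_comm, Real.exp_mul, Real.exp_log (by linarith)]
          norm_cast
        rw [this]
        push_cast
        nlinarith [sq_nonneg (n : ℝ)]
      have h4 := h2.trans (mul_le_mul_of_nonneg_right h3 (Real.exp_pos _).le)
      rw [← Real.exp_add, Real.exp_le_exp] at h4
      linarith
    have ht := hb true
    have hf := hb false
    simp only [if_true, Bool.false_eq_true, if_false] at ht hf
    rw [abs_le]
    constructor
    · by_contra hcon
      push Not at hcon
      nlinarith
    · by_contra hcon
      push Not at hcon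
      nlinarith
  · push Not at hi
    have h1 : |∑ j, A i j * Y j| ≤ 1 := by
      calc _ ≤ ∑ j, |A i j * Y j| := Finset.abs_sum_le_sum_abs _ _
        _ = ∑ j, |A i j| := by simp [abs_mul, hY]
        _ ≤ 1 := hi
    have h2 : 1 / 2 ≤ l := by
      apply Real.le_sqrt_of_sq_le
      norm_num at *
      linarith
    linarith
end

section
/- Let M be a real h×n matrix with columns z₁,…,z_n satisfying ‖z_i‖₂ ≤ 1 for all i ∈ {1,…,n}. Then there exists a linear subspace W of ℝ^n with dim(W) ≥ n/2 such that for every y ∈ W, ‖My‖₂² ≤ 2‖y‖₂². -/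
/-- If `M` is a real `h × n` matrix whose columns all have `ℓ₂`-norm at most `1`,
then there is a subspace `W ⊆ ℝⁿ` with `dim W ≥ n/2` such that `‖My‖₂² ≤ 2‖y‖₂²`
for all `y ∈ W`. -/
theorem subspace_small_operator_norm (h n : ℕ) (M : Matrix (Fin h) (Fin n) ℝ)
    (hcol : ∀ j : Fin n, ∑ i : Fin h, (M i j) ^ 2 ≤ 1) :
    ∃ W : Submodule ℝ (Fin n → ℝ),
      (n : ℝ) / 2 ≤ (Module.finrank ℝ W : ℝ) ∧
      ∀ y ∈ W, ∑ i : Fin h, (M.mulVec y i) ^ 2 ≤ 2 * ∑ j : Fin n, (y j) ^ 2 := by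
  have hps : (M.conjTranspose * M).PosSemidef := Matrix.posSemidef_conjTranspose_mul_self M
  have hA : (M.conjTranspose * M).IsHermitian := hps.1
  have hnn : ∀ j, 0 ≤ hA.eigenvalues j := fun j => hps.eigenvalues_nonneg j
  have htr : ∑ j, hA.eigenvalues j ≤ n := by
    have h1 := hA.trace_eq_sum_eigenvalues
    simp only [RCLike.ofReal_real_eq_id, id] at h1
    rw [← h1]
    have : (M.conjTranspose * M).trace = ∑ j, ∑ i, (M i j) ^ 2 := by
      simp [Matrix.trace, Matrix.mul_apply, pow_two]
    rw [this]
    calc _ ≤ ∑ j : Fin n, (1 : ℝ) := Finset.sum_le_sum fun j _ => hcol j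
      _ = n := by simp
  let U : Matrix (Fin n) (Fin n) ℝ := hA.eigenvectorUnitary
  have hU : U * U.transpose = 1 := by
    have := Unitary.mul_star_self_of_mem hA.eigenvectorUnitary.2
    simpa [U, Matrix.star_eq_conjTranspose] using this
  have hsp : M.transpose * M = U * Matrix.diagonal hA.eigenvalues * U.transpose := by
    have := hA.spectral_theorem
    rw [Unitary.conjStarAlgAut_apply] at this
    simpa [U, Matrix.star_eq_conjTranspose, Function.comp_def] using this
  let B : Finset (Fin n) := Finset.univ.filter fun j => 2 < hA.eigenvalues j
  have hB : 2 * (B.card : ℝ) ≤ n := by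
    calc 2 * (B.card : ℝ) = ∑ j ∈ B, (2 : ℝ) := by simp [mul_comm]
      _ ≤ ∑ j ∈ B, hA.eigenvalues j :=
        Finset.sum_le_sum fun j hj => (Finset.mem_filter.1 hj).2.le
      _ ≤ ∑ j, hA.eigenvalues j :=
        Finset.sum_le_sum_of_subset_of_nonneg (Finset.subset_univ _) fun j _ _ => hnn j
      _ ≤ n := htr
  let f : (Fin n → ℝ) →ₗ[ℝ] (B → ℝ) :=
    (LinearMap.funLeft ℝ ℝ (fun j : B => (j : Fin n))).comp U.transpose.mulVecLin
  refine ⟨LinearMap.ker f, ?_, ?_⟩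
  · have h1 := LinearMap.finrank_range_add_finrank_ker f
    have h2 := Submodule.finrank_le (LinearMap.range f)
    simp only [Module.finrank_fintype_fun_eq_card, Fintype.card_fin, Fintype.card_coe] at h1 h2
    have h3 : (n : ℝ) ≤ B.card + Module.finrank ℝ (LinearMap.ker f) := by
      exact_mod_cast (by omega : n ≤ B.card + Module.finrank ℝ (LinearMap.ker f))
    linarith
  · intro y hy
    have hc : ∀ j ∈ B, U.transpose.mulVec y j = 0 := fun j hj =>
      congrFun (LinearMap.mem_ker.1 hy) ⟨j, hj⟩
    have e1 : ∑ i, (M.mulVec y i) ^ 2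
        = ∑ j, hA.eigenvalues j * (U.transpose.mulVec y j) ^ 2 := by
      have : M.mulVec y ⬝ᵥ M.mulVec y = U.transpose.mulVec y ⬝ᵥ
          (Matrix.diagonal hA.eigenvalues).mulVec (U.transpose.mulVec y) := by
        rw [Matrix.dotProduct_mulVec, ← Matrix.mulVec_transpose, Matrix.mulVec_mulVec, hsp,
          Matrix.mulVec_transpose U y, ← Matrix.dotProduct_mulVec, ← Matrix.mulVec_transpose U y,
          Matrix.mulVec_mulVec, Matrix.mulVec_mulVec, dotProduct_comm, Matrix.mul_assoc]
      simp only [dotProduct, Matrix.mulVec_diagonal] at this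
      simp only [pow_two, this]
      exact Finset.sum_congr rfl fun j _ => by ring
    have e2 : ∑ j, (y j) ^ 2 = ∑ j, (U.transpose.mulVec y j) ^ 2 := by
      have : y ⬝ᵥ y = U.transpose.mulVec y ⬝ᵥ U.transpose.mulVec y := by
        rw [Matrix.dotProduct_mulVec, ← Matrix.mulVec_transpose, Matrix.mulVec_mulVec,
          Matrix.transpose_transpose, hU, Matrix.one_mulVec]
      simpa only [dotProduct, ← pow_two] using this
    rw [e1, e2, Finset.mul_sum]
    refine Finset.sum_le_sum fun j _ => ?_
    by_cases hj : j ∈ B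
    · simp [hc j hj]
    · have : hA.eigenvalues j ≤ 2 := by simpa [B] using hj
      exact mul_le_mul_of_nonneg_right this (sq_nonneg _)
end

section
/- Let n, t ≥ 1 and let ℬ and ℒ be finite families of subsets of {1,…,n} such that every element i ∈ {1,…,n} lies in at most t sets of ℬ ∪ ℒ, and every set S ∈ ℬ satisfies |S| ≥ 6t. Let x ∈ ℝ^n with |x_i| ≤ 1 for all i. For each subset S, let v_S ∈ ℝ^n be the 0/1 indicator vector of S, let x_S ∈ ℝ^n be the vector with (x_S)_i = x_i for i ∈ S and 0 otherwise, and let I_S be the diagonal n×n matrix with (I_S)_{ii} = 1 if i ∈ S and 0 otherwise. Suppose b ∈ ℝ^n with b_i ≥ 0 for all i, α_S ∈ ℝ for each S ∈ ℬ, and β_S ≥ 0, β_S^x ≥ 0 for each S ∈ ℒ satisfy the positive semidefiniteness constraint ∑_{i=1}^n b_i e_i e_iᵀ + ∑_{S∈ℬ} α_S v_S v_Sᵀ + ∑_{S∈ℒ} ( β_S (v_S v_Sᵀ − 2 I_S) + β_S^x (x_S x_Sᵀ − 2 I_S) ) ⪰ I, where I is the n×n identity matrix. Then ∑_{i=1}^n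 b_i ≥ n/3. -/
lemma aux_quad {n : ℕ} (w z : Fin n → ℝ) :
    z ⬝ᵥ (Matrix.vecMulVec w w).mulVec z = (∑ i, w i * z i) ^ 2 := by
  rw [Matrix.vecMulVec_mulVec]
  simp only [dotProduct, Pi.smul_apply, MulOpposite.smul_eq_mul_unop, MulOpposite.unop_op]
  rw [sq, Finset.sum_mul]
  exact Finset.sum_congr rfl fun i _ => by ring

lemma aux_diag {n : ℕ} (w z : Fin n → ℝ) :
    z ⬝ᵥ (Matrix.diagonal w).mulVec z = ∑ i, w i * z i ^ 2 := by
  simp only [dotProduct, Matrix.mulVec_diagonal]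
  exact Finset.sum_congr rfl fun i _ => by ring

lemma aux_bessel {n m : ℕ} (u : Fin m → EuclideanSpace ℝ (Fin n)) (hu : Orthonormal ℝ u)
    (w : Fin n → ℝ) : ∑ k, (∑ i, w i * u k i) ^ 2 ≤ ∑ i, w i ^ 2 := by
  have h := hu.sum_inner_products_le (WithLp.toLp 2 w) (s := Finset.univ)
  simpa [EuclideanSpace.norm_sq_eq, PiLp.inner_apply, Real.norm_eq_abs, sq_abs] using h

lemma aux_onb {n : ℕ} (B : Finset (Finset (Fin n))) (w : Finset (Fin n) → Fin n → ℝ) :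
    ∃ (m : ℕ) (u : Fin m → EuclideanSpace ℝ (Fin n)), n ≤ m + B.card ∧ Orthonormal ℝ u ∧
      ∀ k, ∀ S ∈ B, ∑ i, w S i * u k i = 0 := by
  let f : EuclideanSpace ℝ (Fin n) →ₗ[ℝ] (B → ℝ) :=
    LinearMap.pi fun S => ∑ i, w S i • (EuclideanSpace.proj i : EuclideanSpace ℝ (Fin n) →L[ℝ] ℝ).toLinearMap
  have h1 := f.finrank_range_add_finrank_ker
  have h2 : Module.finrank ℝ f.range ≤ B.card := by
    simpa using Submodule.finrank_le f.range
  let e := stdOrthonormalBasis ℝ f.ker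
  refine ⟨Module.finrank ℝ f.ker, fun k => (e k : EuclideanSpace ℝ (Fin n)), ?_, ?_, ?_⟩
  · rw [finrank_euclideanSpace_fin] at h1
    omega
  · exact e.orthonormal.comp_linearIsometry f.ker.subtypeₗᵢ
  · intro k S hS
    have h := congrFun (LinearMap.mem_ker.1 (e k).2) ⟨S, hS⟩
    simpa [f] using h

/-- Dual lower bound: if every element of `{1,…,n}` lies in at most `t` sets of
`ℬ ∪ ℒ`, every set of `ℬ` has at least `6t` elements, `|xᵢ| ≤ 1`, and dual
multipliers `b ≥ 0`, `α`, `β ≥ 0`, `β^x ≥ 0` satisfy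
`∑ᵢ bᵢ eᵢeᵢᵀ + ∑_{S∈ℬ} α_S v_S v_Sᵀ + ∑_{S∈ℒ} (β_S (v_S v_Sᵀ − 2I_S) + β_S^x (x_S x_Sᵀ − 2I_S)) ⪰ I`,
then `∑ᵢ bᵢ ≥ n/3`. -/
theorem dual_lower_bound (n t : ℕ) (hn : 1 ≤ n) (ht : 1 ≤ t)
    (ℬ ℒ : Finset (Finset (Fin n)))
    (hdeg : ∀ i : Fin n, ((ℬ ∪ ℒ).filter fun S => i ∈ S).card ≤ t)
    (hbig : ∀ S ∈ ℬ, 6 * t ≤ S.card)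
    (x : Fin n → ℝ) (hx : ∀ i, |x i| ≤ 1)
    (b : Fin n → ℝ) (hb : ∀ i, 0 ≤ b i)
    (α : Finset (Fin n) → ℝ)
    (β βx : Finset (Fin n) → ℝ)
    (hβ : ∀ S ∈ ℒ, 0 ≤ β S) (hβx : ∀ S ∈ ℒ, 0 ≤ βx S)
    (hpsd :
      (Matrix.diagonal b +
        ∑ S ∈ ℬ, α S • Matrix.vecMulVec (fun i => if i ∈ S then (1 : ℝ) else 0)
                        (fun i => if i ∈ S then (1 : ℝ) else 0) +
        ∑ S ∈ ℒ,
          (β S • (Matrix.vecMulVec (fun i => if i ∈ S then (1 : ℝ) else 0)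
                    (fun i => if i ∈ S then (1 : ℝ) else 0) -
                  2 • Matrix.diagonal (fun i => if i ∈ S then (1 : ℝ) else 0)) +
           βx S • (Matrix.vecMulVec (fun i => if i ∈ S then x i else 0)
                    (fun i => if i ∈ S then x i else 0) -
                  2 • Matrix.diagonal (fun i => if i ∈ S then (1 : ℝ) else 0))) -
        (1 : Matrix (Fin n) (Fin n) ℝ)).PosSemidef) :
    (n : ℝ) / 3 ≤ ∑ i : Fin n, b i := by
  classical
  have hquad : ∀ z : Fin n → ℝ, (∀ S ∈ ℬ, ∑ i, (if i ∈ S then (1:ℝ) else 0) * z i = 0) →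
      0 ≤ ∑ i, b i * z i ^ 2 + ∑ S ∈ ℒ, (β S * ((∑ i, (if i ∈ S then (1:ℝ) else 0) * z i) ^ 2
          - 2 * ∑ i, (if i ∈ S then (1:ℝ) else 0) * z i ^ 2) +
        βx S * ((∑ i, (if i ∈ S then x i else 0) * z i) ^ 2
          - 2 * ∑ i, (if i ∈ S then (1:ℝ) else 0) * z i ^ 2)) - ∑ i, z i ^ 2 := by
    intro z hz
    have h := hpsd.dotProduct_mulVec_nonneg z
    have hone : z ⬝ᵥ z = ∑ i, z i ^ 2 := by simp [dotProduct, sq]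
    have h0 : ∑ S ∈ ℬ, α S * (∑ i, (if i ∈ S then (1:ℝ) else 0) * z i) ^ 2 = 0 :=
      Finset.sum_eq_zero fun S hS => by rw [hz S hS]; ring
    simp only [star_trivial, Matrix.sub_mulVec, Matrix.add_mulVec, Matrix.sum_mulVec,
      Matrix.smul_mulVec, dotProduct_sub, dotProduct_add, dotProduct_sum, dotProduct_smul,
      aux_quad, aux_diag, Matrix.one_mulVec, smul_eq_mul, two_nsmul, hone, h0,
      add_zero] at h
    simp only [← two_mul] at h
    exact h
  set d : Fin n → ℝ := fun i => ∑ S ∈ ℒ, (β S + βx S) * (if i ∈ S then (1:ℝ) else 0) with hd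
  have hd0 : ∀ i, 0 ≤ d i := fun i => Finset.sum_nonneg fun S hS =>
    mul_nonneg (add_nonneg (hβ S hS) (hβx S hS)) (by split_ifs <;> norm_num)
  set r : Fin n → ℝ := fun i => √(1 / (1 + 2 * d i)) with hr
  have hr2 : ∀ i, r i ^ 2 = 1 / (1 + 2 * d i) := fun i =>
    Real.sq_sqrt (by have := hd0 i; positivity)
  have hr1 : ∀ i, r i ^ 2 * (1 + 2 * d i) = 1 := fun i => by
    have := hd0 i
    rw [hr2]; field_simp
  have hswap : ∀ g : Fin n → ℝ, ∑ S ∈ ℒ, (β S + βx S) * ∑ i, (if i ∈ S then (1:ℝ) else 0) * g i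
      = ∑ i, d i * g i := by
    intro g
    simp only [hd, Finset.mul_sum, Finset.sum_mul]
    rw [Finset.sum_comm]
    exact Finset.sum_congr rfl fun i _ => Finset.sum_congr rfl fun S _ => by ring
  obtain ⟨m, u, hm, hu, hker⟩ := aux_onb ℬ (fun S i => (if i ∈ S then (1:ℝ) else 0) * r i)
  have hunit : ∀ k, ∑ i, u k i ^ 2 = 1 := fun k => by
    have h := hu.1 k
    have h2 := EuclideanSpace.norm_sq_eq (u k)
    rw [h] at h2
    simpa [Real.norm_eq_abs, sq_abs] using h2.symm
  have hk : ∀ k, (1:ℝ) ≤ ∑ i, b i * u k i ^ 2 +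
      ∑ S ∈ ℒ, (β S * (∑ i, ((if i ∈ S then (1:ℝ) else 0) * r i) * u k i) ^ 2 +
        βx S * (∑ i, ((if i ∈ S then x i else 0) * r i) * u k i) ^ 2) := by
    intro k
    have h := hquad (fun i => r i * u k i) (fun S hS => by
      simpa only [mul_assoc] using hker k S hS)
    have hs := hswap (fun i => (r i * u k i) ^ 2)
    have hsum : ∑ i, (r i * u k i) ^ 2 + 2 * ∑ i, d i * (r i * u k i) ^ 2 = 1 := by
      rw [← hunit k, Finset.mul_sum, ← Finset.sum_add_distrib]
      refine Finset.sum_congr rfl fun i _ => ?_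
      linear_combination (u k i ^ 2) * hr1 i
    have hbb : ∑ i, b i * (r i * u k i) ^ 2 ≤ ∑ i, b i * u k i ^ 2 := by
      refine Finset.sum_le_sum fun i _ => mul_le_mul_of_nonneg_left ?_ (hb i)
      have h1 : r i ^ 2 ≤ 1 := by nlinarith [hr1 i, hd0 i, sq_nonneg (r i)]
      rw [mul_pow]
      nlinarith [sq_nonneg (u k i)]
    have hL : ∑ S ∈ ℒ, (β S * ((∑ i, (if i ∈ S then (1:ℝ) else 0) * (r i * u k i)) ^ 2
          - 2 * ∑ i, (if i ∈ S then (1:ℝ) else 0) * (r i * u k i) ^ 2) +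
        βx S * ((∑ i, (if i ∈ S then x i else 0) * (r i * u k i)) ^ 2
          - 2 * ∑ i, (if i ∈ S then (1:ℝ) else 0) * (r i * u k i) ^ 2)) =
      ∑ S ∈ ℒ, (β S * (∑ i, ((if i ∈ S then (1:ℝ) else 0) * r i) * u k i) ^ 2 +
        βx S * (∑ i, ((if i ∈ S then x i else 0) * r i) * u k i) ^ 2)
      - 2 * ∑ S ∈ ℒ, (β S + βx S) * ∑ i, (if i ∈ S then (1:ℝ) else 0) * (r i * u k i) ^ 2 := by
      rw [Finset.mul_sum, ← Finset.sum_sub_distrib]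
      refine Finset.sum_congr rfl fun S _ => ?_
      simp only [mul_assoc]
      ring
    linarith
  have hsumk := Finset.sum_le_sum (s := Finset.univ) fun k _ => hk k
  rw [Finset.sum_add_distrib] at hsumk
  have hA : ∑ k, ∑ i, b i * u k i ^ 2 ≤ ∑ i, b i := by
    rw [Finset.sum_comm]
    refine Finset.sum_le_sum fun i _ => ?_
    rw [← Finset.mul_sum]
    have h := aux_bessel u hu (Pi.single i 1)
    simp [Pi.single_apply] at h
    nlinarith [hb i]
  have hB : ∑ k, ∑ S ∈ ℒ, (β S * (∑ i, ((if i ∈ S then (1:ℝ) else 0) * r i) * u k i) ^ 2 +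
        βx S * (∑ i, ((if i ∈ S then x i else 0) * r i) * u k i) ^ 2) ≤ ∑ i, d i * r i ^ 2 := by
    rw [Finset.sum_comm, ← hswap]
    refine Finset.sum_le_sum fun S hS => ?_
    rw [Finset.sum_add_distrib, ← Finset.mul_sum, ← Finset.mul_sum, add_mul]
    refine add_le_add (mul_le_mul_of_nonneg_left ?_ (hβ S hS))
      (mul_le_mul_of_nonneg_left ?_ (hβx S hS))
    · refine (aux_bessel u hu _).trans (Finset.sum_le_sum fun i _ => ?_)
      split_ifs <;> simp
    · refine (aux_bessel u hu _).trans (Finset.sum_le_sum fun i _ => ?_)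
      split_ifs
      · have h1 : x i ^ 2 ≤ 1 := (sq_le_one_iff_abs_le_one _).2 (hx i)
        rw [mul_pow]
        nlinarith [sq_nonneg (r i)]
      · simp
  have hC : ∑ i, d i * r i ^ 2 ≤ n / 2 := by
    have : ∑ i, d i * r i ^ 2 ≤ ∑ _i : Fin n, (1/2 : ℝ) :=
      Finset.sum_le_sum fun i _ => by nlinarith [hr1 i, sq_nonneg (r i)]
    refine this.trans (le_of_eq ?_)
    simp
    ring
  have hcard : 6 * ℬ.card ≤ n := by
    have h1 : ℬ.card * (6 * t) ≤ ∑ S ∈ ℬ, S.card := by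
      simpa using Finset.card_nsmul_le_sum ℬ _ _ hbig
    have h2 : ∑ S ∈ ℬ, S.card = ∑ i : Fin n, (ℬ.filter fun S => i ∈ S).card := by
      simp only [Finset.card_filter]
      rw [Finset.sum_comm]
      simp
    have h3 : ∑ i : Fin n, (ℬ.filter fun S => i ∈ S).card ≤ ∑ _i : Fin n, t :=
      Finset.sum_le_sum fun i _ => (Finset.card_le_card
        (Finset.filter_subset_filter _ Finset.subset_union_left)).trans (hdeg i)
    simp at h3
    have h4 : (6 * ℬ.card) * t ≤ n * t := by
      calc (6 * ℬ.card) * t = ℬ.card * (6 * t) := by ring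
        _ ≤ n * t := by omega
    exact Nat.le_of_mul_le_mul_right h4 ht
  have hm' : (n:ℝ) ≤ m + ℬ.card := by exact_mod_cast hm
  have hcard' : 6 * (ℬ.card : ℝ) ≤ n := by exact_mod_cast hcard
  simp only [Finset.sum_const, Finset.card_univ, Fintype.card_fin, nsmul_eq_mul, mul_one] at hsumk
  linarith
end

section
/- Let n, t ≥ 1 and let ℬ and ℒ be finite families of subsets of {1,…,n} such that every element i ∈ {1,…,n} lies in at most t sets of ℬ ∪ ℒ, and every set S ∈ ℬ satisfies |S| ≥ 6t. Let x ∈ ℝ^n with |x_i| ≤ 1 for all i. Then there exist vectors u₁,…,u_n ∈ ℝ^n satisfying: (i) ‖u_i‖₂ ≤ 1 for all i; (ii) ∑_{i∈S} u_i = 0 for every S ∈ ℬ; (iii) ‖∑_{i∈S} u_i‖₂² ≤ 2 ∑_{i∈S} ‖u_i‖₂² for every S ∈ ℒ; (iv) ‖∑_{i∈S} x_i u_i‖₂² ≤ 2 ∑_{i∈S} ‖u_i‖₂² for every S ∈ ℒ; and (v) ∑_{i=1}^n ‖u_i‖₂² ≥ n/3. -/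
section helpers
open Matrix

lemma pd_of {n : ℕ} (K : Matrix (Fin n) (Fin n) ℝ) (hK : K.PosSemidef) (e : Fin n → ℝ)
    (he : ∀ i, 1 ≤ e i) : (diagonal e + K).PosDef :=
  (Matrix.PosDef.diagonal (fun i => by linarith [he i])).add_posSemidef hK

lemma det_one_add_pos {n : ℕ} (K : Matrix (Fin n) (Fin n) ℝ) (hK : K.PosSemidef) (d : Fin n → ℝ)
    (hd : ∀ i, 0 ≤ d i) : 0 < (1 + diagonal d * K).det := by
  have h1 : diagonal d = diagonal (fun i => √(d i)) * diagonal (fun i => √(d i)) := by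
    rw [diagonal_mul_diagonal]; congr 1; ext i; exact (Real.mul_self_sqrt (hd i)).symm
  rw [h1, Matrix.mul_assoc, det_one_add_mul_comm]
  apply Matrix.PosDef.det_pos
  apply Matrix.PosDef.one.add_posSemidef
  have := hK.conjTranspose_mul_mul_same (diagonal (fun i => √(d i)))
  simpa [diagonal_conjTranspose] using this

lemma optE {n : ℕ} (K : Matrix (Fin n) (Fin n) ℝ) (hK : K.PosSemidef) :
    ∃ e : Fin n → ℝ, (∀ i, 1 ≤ e i) ∧ ∀ e' : Fin n → ℝ, (∀ i, 1 ≤ e' i) →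
      (∏ i, e' i) * (diagonal e + K).det ^ 2 ≤ (∏ i, e i) * (diagonal e' + K).det ^ 2 := by
  have hcomp : IsCompact (Set.Icc (0 : Fin n → ℝ) 1) := isCompact_Icc
  have hcont : ContinuousOn (fun d : Fin n → ℝ => (∏ i, d i) / (1 + diagonal d * K).det ^ 2)
      (Set.Icc (0 : Fin n → ℝ) 1) := by
    apply ContinuousOn.div
    · fun_prop
    · apply Continuous.continuousOn
      apply Continuous.pow
      apply Continuous.matrix_det
      fun_prop
    · intro d hd
      exact pow_ne_zero _ (det_one_add_pos K hK d (fun i => hd.1 i)).ne'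
  obtain ⟨d, hd, hmax⟩ := hcomp.exists_isMaxOn ⟨0, by simp⟩ hcont
  have hmax' : ∀ d' ∈ Set.Icc (0 : Fin n → ℝ) 1, (∏ i, d' i) / (1 + diagonal d' * K).det ^ 2 ≤
    (∏ i, d i) / (1 + diagonal d * K).det ^ 2 := hmax
  have hD := det_one_add_pos K hK d (fun i => hd.1 i)
  have hprod : 0 < ∏ i, d i := by
    have h1 := hmax' 1 (by simp)
    have hD1 := det_one_add_pos K hK 1 (fun i => by simp)
    have h2 : 0 < (∏ i, (1 : Fin n → ℝ) i) / (1 + diagonal 1 * K).det ^ 2 := by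
      simp only [Pi.one_apply, Finset.prod_const_one]; positivity
    have h3 := h2.trans_le h1
    by_contra hc
    have := div_nonpos_of_nonpos_of_nonneg (not_lt.mp hc) (sq_nonneg (1 + diagonal d * K).det)
    linarith
  have hdpos : ∀ i, 0 < d i := fun i => lt_of_le_of_ne (hd.1 i)
    (fun h => hprod.ne' (Finset.prod_eq_zero (Finset.mem_univ i) h.symm))
  have key : ∀ e : Fin n → ℝ, (∀ i, 0 < e i) →
      (diagonal e + K).det = (∏ i, e i) * (1 + diagonal (fun i => (e i)⁻¹) * K).det := by
    intro e he
    rw [← det_diagonal, ← det_mul, Matrix.mul_add, Matrix.mul_one, ← Matrix.mul_assoc,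
      diagonal_mul_diagonal]
    have : (fun i => e i * (e i)⁻¹) = fun _ => 1 := by
      ext i; exact mul_inv_cancel₀ (he i).ne'
    rw [this, diagonal_one, Matrix.one_mul]
  refine ⟨fun i => (d i)⁻¹, fun i => (one_le_inv₀ (hdpos i)).2 (hd.2 i), fun e' he' => ?_⟩
  have he0 : ∀ i, 0 < e' i := fun i => by linarith [he' i]
  rw [key _ he0, key _ (fun i => inv_pos.2 (hdpos i))]
  have h1 := hmax' (fun i => (e' i)⁻¹)
    ⟨fun i => (inv_pos.2 (he0 i)).le, fun i => inv_le_one_of_one_le₀ (he' i)⟩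
  have hD' := det_one_add_pos K hK (fun i => (e' i)⁻¹) (fun i => (inv_pos.2 (he0 i)).le)
  simp only [inv_inv]
  rw [Finset.prod_inv_distrib] at h1 ⊢
  have hp' : 0 < ∏ i, e' i := Finset.prod_pos fun i _ => he0 i
  generalize (∏ i, e' i) = p' at *
  generalize (∏ i, d i) = p at *
  generalize (1 + diagonal d * K).det = D at *
  generalize (1 + diagonal (fun i => (e' i)⁻¹) * K).det = D' at *
  rw [div_le_div_iff₀ (by positivity) (by positivity)] at h1
  have h2 : D ^ 2 ≤ p * p' * D' ^ 2 := by
    calc D ^ 2 = p' * (p'⁻¹ * D ^ 2) := by field_simp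
      _ ≤ p' * (p * D' ^ 2) := by gcongr
      _ = _ := by ring
  calc p' * (p⁻¹ * D) ^ 2 = p' * p⁻¹ ^ 2 * D ^ 2 := by ring
    _ ≤ p' * p⁻¹ ^ 2 * (p * p' * D' ^ 2) := by gcongr
    _ = p⁻¹ * (p' * D') ^ 2 := by field_simp

lemma det_pert {n : ℕ} (H : Matrix (Fin n) (Fin n) ℝ) (hH : H.PosDef) (i : Fin n) (s : ℝ) :
    (H + diagonal (Pi.single i s)).det = H.det * (1 + s * H⁻¹ i i) := by
  have h := det_add_replicateCol_mul_replicateRow (ι := Unit) (A := H)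
    (hH.det_pos.ne'.isUnit) (Pi.single i s) (Pi.single i 1)
  have h2 : replicateCol Unit (Pi.single i s : Fin n → ℝ) * replicateRow Unit (Pi.single i (1:ℝ)) =
      diagonal (Pi.single i s) := by
    ext a b
    simp [Matrix.mul_apply, diagonal_apply, Pi.single_apply]
    grind
  rw [h2] at h
  rw [h]
  congr 1
  simp [det_unique, Matrix.mul_apply, Pi.single_apply]
  ring

lemma stat {n : ℕ} (K : Matrix (Fin n) (Fin n) ℝ) (hK : K.PosSemidef) :
    ∃ e : Fin n → ℝ, (∀ i, 1 ≤ e i) ∧ (∀ i, 1 ≤ 2 * (e i * (diagonal e + K)⁻¹ i i)) ∧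
      (∀ i, 1 < e i → 2 * (e i * (diagonal e + K)⁻¹ i i) ≤ 1) := by
  obtain ⟨e, he, hopt⟩ := optE K hK
  have hH := pd_of K hK e he
  have main : ∀ i s, 1 ≤ e i + s →
      s ≤ e i * (2 * s * (diagonal e + K)⁻¹ i i + s ^ 2 * ((diagonal e + K)⁻¹ i i) ^ 2) := by
    intro i s hs
    have h := hopt (e + Pi.single i s) (fun j => by
      by_cases hj : j = i
      · subst hj; simpa using hs
      · simpa [hj] using he j)
    have h1 : diagonal (e + Pi.single i s) + K = (diagonal e + K) + diagonal (Pi.single i s) := by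
      have : diagonal (e + Pi.single i s) = diagonal e + diagonal (Pi.single i s) :=
        (diagonal_add e (Pi.single i s)).symm
      rw [this]; abel
    rw [h1, det_pert _ hH] at h
    have hsplit : ∀ f : Fin n → ℝ, ∏ j, f j = f i * ∏ j ∈ Finset.univ.erase i, f j :=
      fun f => (Finset.mul_prod_erase _ _ (Finset.mem_univ i)).symm
    rw [hsplit, hsplit e] at h
    have h2 : ∏ j ∈ Finset.univ.erase i, (e + Pi.single i s : Fin n → ℝ) j =
        ∏ j ∈ Finset.univ.erase i, e j := by
      apply Finset.prod_congr rfl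
      intro j hj
      simp [Finset.ne_of_mem_erase hj]
    have hp : 0 < ∏ j ∈ Finset.univ.erase i, e j :=
      Finset.prod_pos fun j _ => by linarith [he j]
    have hdet := hH.det_pos
    rw [h2] at h
    simp only [Pi.add_apply, Pi.single_eq_same] at h
    generalize (diagonal e + K)⁻¹ i i = U at *
    generalize (diagonal e + K).det = D at *
    generalize ∏ j ∈ Finset.univ.erase i, e j = p at *
    have h3 : (p * D ^ 2) * (e i + s) ≤ (p * D ^ 2) * (e i * (1 + s * U) ^ 2) := by linarith
    have h4 := le_of_mul_le_mul_left h3 (by positivity)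
    linarith
  have hU0 : ∀ i, 0 < (diagonal e + K)⁻¹ i i := fun i => hH.inv.diag_pos
  refine ⟨e, he, fun i => ?_, fun i hi => ?_⟩
  · have hei := he i
    have hm := main i
    have hu := hU0 i
    generalize (diagonal e + K)⁻¹ i i = U at *
    by_contra! hc
    set δ := 1 - 2 * (e i * U) with hδ
    have hδ0 : 0 < δ := by linarith
    have hq : 0 < e i * U ^ 2 := by positivity
    have h := hm (δ / (2 * (e i * U ^ 2))) (by have : 0 < δ / (2 * (e i * U ^ 2)) := by positivity
                                               linarith)
    set s := δ / (2 * (e i * U ^ 2)) with hs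
    have hs0 : 0 < s := by positivity
    have h5 : s * (e i * U ^ 2) = δ / 2 := by rw [hs]; field_simp
    have h6 : s * δ ≤ s * (s * (e i * U ^ 2)) := by rw [hδ]; linarith
    have := le_of_mul_le_mul_left h6 hs0
    linarith
  · have hm := main i
    have hu := hU0 i
    generalize (diagonal e + K)⁻¹ i i = U at *
    by_contra! hc
    set δ := 2 * (e i * U) - 1 with hδ
    have hδ0 : 0 < δ := by linarith
    have hq : 0 < e i * U ^ 2 := by positivity
    set s := min (e i - 1) (δ / (2 * (e i * U ^ 2))) with hs
    have hs0 : 0 < s := lt_min (by linarith) (by positivity)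
    have h := hm (-s) (by have := min_le_left (e i - 1) (δ / (2 * (e i * U ^ 2))); linarith)
    have h5 : s * (e i * U ^ 2) ≤ δ / 2 := by
      calc s * (e i * U ^ 2) ≤ δ / (2 * (e i * U ^ 2)) * (e i * U ^ 2) := by
            gcongr; exact min_le_right _ _
        _ = δ / 2 := by field_simp
    have h6 : s * δ ≤ s * (s * (e i * U ^ 2)) := by rw [hδ]; linarith
    have := le_of_mul_le_mul_left h6 hs0
    linarith

lemma approx {n : ℕ} (ℬ : Finset (Finset (Fin n))) (l : ℝ) (hl : 0 < l) :
    ∃ u : Fin n → EuclideanSpace ℝ (Fin n), (∀ i, ‖u i‖ ≤ 1) ∧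
      (∀ c : Fin n → ℝ, ‖∑ i, c i • u i‖ ^ 2 ≤ 2 * ∑ i, c i ^ 2 * ‖u i‖ ^ 2) ∧
      (∀ S ∈ ℬ, ‖∑ i ∈ S, u i‖ ^ 2 ≤ l) ∧
      (n : ℝ) - 2 * (ℬ.card : ℝ) ≤ ∑ i, ‖u i‖ ^ 2 := by
  set ind : Finset (Fin n) → Fin n → ℝ := fun S i => if i ∈ S then 1 else 0 with hind
  set K : Matrix (Fin n) (Fin n) ℝ := ∑ S ∈ ℬ, l⁻¹ • vecMulVec (ind S) (ind S) with hKdef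
  have hK : K.PosSemidef := by
    apply posSemidef_sum
    intro S _
    apply PosSemidef.smul _ (by positivity)
    simpa using posSemidef_vecMulVec_self_star (ind S)
  have hKv : ∀ v : Fin n → ℝ, K *ᵥ v = ∑ S ∈ ℬ, (l⁻¹ * (ind S ⬝ᵥ v)) • ind S := by
    intro v
    rw [hKdef, Matrix.sum_mulVec]
    refine Finset.sum_congr rfl fun S _ => ?_
    rw [Matrix.smul_mulVec, vecMulVec_mulVec]
    ext j; simp [mul_comm, mul_left_comm]
  have hKq : ∀ v : Fin n → ℝ, v ⬝ᵥ K *ᵥ v = ∑ S ∈ ℬ, l⁻¹ * (ind S ⬝ᵥ v) ^ 2 := by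
    intro v
    rw [hKv, dotProduct_sum]
    refine Finset.sum_congr rfl fun S _ => ?_
    rw [dotProduct_smul, dotProduct_comm v, smul_eq_mul]; ring
  obtain ⟨e, he, hst1, hst2⟩ := stat K hK
  have hH := pd_of K hK e he
  set H := diagonal e + K with hHdef
  have hdet : IsUnit H.det := hH.det_pos.ne'.isUnit
  have hU := hH.inv
  set U := H⁻¹ with hUdef
  have hHU : H * U = 1 := Matrix.mul_nonsing_inv H hdet
  -- quadratic form facts
  have hquad : ∀ c : Fin n → ℝ, c ⬝ᵥ U *ᵥ c =
      ∑ i, e i * (U *ᵥ c) i ^ 2 + ∑ S ∈ ℬ, l⁻¹ * (ind S ⬝ᵥ (U *ᵥ c)) ^ 2 := by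
    intro c
    have h1 : c = H *ᵥ (U *ᵥ c) := by rw [Matrix.mulVec_mulVec, hHU, Matrix.one_mulVec]
    rw [← hKq]
    conv_lhs => rw [dotProduct_comm]; rhs; rw [h1]
    rw [hHdef, Matrix.add_mulVec, dotProduct_add]
    congr 1
    simp only [dotProduct, mulVec_diagonal]
    refine Finset.sum_congr rfl fun i _ => ?_
    ring
  have hepos : ∀ i, 0 < e i := fun i => by linarith [he i]
  have hle : ∀ c : Fin n → ℝ, c ⬝ᵥ U *ᵥ c ≤ ∑ i, c i ^ 2 * (e i)⁻¹ := by
    intro c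
    have h1 := hquad c
    have h2 : 0 ≤ ∑ S ∈ ℬ, l⁻¹ * (ind S ⬝ᵥ (U *ᵥ c)) ^ 2 :=
      Finset.sum_nonneg fun S _ => by positivity
    have h3 : 2 * (c ⬝ᵥ U *ᵥ c) ≤ ∑ i, c i ^ 2 * (e i)⁻¹ + ∑ i, e i * (U *ᵥ c) i ^ 2 := by
      rw [← Finset.sum_add_distrib, dotProduct, Finset.mul_sum]
      refine Finset.sum_le_sum fun i _ => ?_
      have hi := hepos i
      have h4 : 0 ≤ (e i)⁻¹ * (c i - e i * (U *ᵥ c) i) ^ 2 := by positivity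
      have h5 : (e i)⁻¹ * (c i - e i * (U *ᵥ c) i) ^ 2 =
        c i ^ 2 * (e i)⁻¹ + e i * (U *ᵥ c) i ^ 2 - 2 * (c i * (U *ᵥ c) i) := by
        field_simp; ring
      linarith
    linarith
  have hS : ∀ S ∈ ℬ, ind S ⬝ᵥ U *ᵥ ind S ≤ l := by
    intro S hSm
    have h1 := hquad (ind S)
    have h2 : 0 ≤ ∑ i, e i * (U *ᵥ ind S) i ^ 2 :=
      Finset.sum_nonneg fun i _ => mul_nonneg (hepos i).le (sq_nonneg _)
    have h3 := Finset.single_le_sum (f := fun T => l⁻¹ * (ind T ⬝ᵥ (U *ᵥ ind S)) ^ 2)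
      (fun T _ => by positivity) hSm
    by_contra! hc
    have h4 : l⁻¹ * (ind S ⬝ᵥ U *ᵥ ind S) ^ 2 ≤ ind S ⬝ᵥ U *ᵥ ind S := by linarith
    generalize ind S ⬝ᵥ U *ᵥ ind S = a at *
    have h5 : a ^ 2 ≤ l * a := by
      calc a ^ 2 = l * (l⁻¹ * a ^ 2) := by field_simp
        _ ≤ l * a := by gcongr
    nlinarith
  have htr : (n : ℝ) - ∑ i, e i * U i i ≤ ℬ.card := by
    have h1 : (H * U).trace = n := by rw [hHU]; simp
    rw [hHdef, Matrix.add_mul, trace_add] at h1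
    have h2 : (diagonal e * U).trace = ∑ i, e i * U i i := by
      simp [trace, diagonal_mul]
    have h3 : (K * U).trace = ∑ S ∈ ℬ, l⁻¹ * (ind S ⬝ᵥ U *ᵥ ind S) := by
      rw [hKdef, Matrix.sum_mul, trace_sum]
      refine Finset.sum_congr rfl fun S _ => ?_
      rw [Matrix.smul_mul, trace_smul, smul_eq_mul, vecMulVec_mul, trace_vecMulVec,
        dotProduct_mulVec, dotProduct_comm]
    have h4 : (K * U).trace ≤ ℬ.card := by
      rw [h3]
      calc ∑ S ∈ ℬ, l⁻¹ * (ind S ⬝ᵥ U *ᵥ ind S) ≤ ∑ S ∈ ℬ, (1 : ℝ) := by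
            refine Finset.sum_le_sum fun S hSm => ?_
            calc _ ≤ l⁻¹ * l := by gcongr; exact hS S hSm
              _ = 1 := by field_simp
        _ = ℬ.card := by simp
    linarith
  obtain ⟨A, hA⟩ : ∃ A : Matrix (Fin n) (Fin n) ℝ, U = Aᵀ * A := by
    open scoped MatrixOrder Matrix.Norms.L2Operator in
    obtain ⟨A, hA⟩ := CStarAlgebra.nonneg_iff_eq_star_mul_self.mp hU.posSemidef.nonneg
    exact ⟨A, by simpa [star_eq_conjTranspose] using hA⟩
  let u : Fin n → EuclideanSpace ℝ (Fin n) := fun i => WithLp.toLp 2 (fun k => A k i)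
  have hu : ∀ c : Fin n → ℝ, ‖∑ i, c i • u i‖ ^ 2 = c ⬝ᵥ U *ᵥ c := by
    intro c
    have h1 : ∑ i, c i • u i = WithLp.toLp 2 (A *ᵥ c) := by
      ext k
      simp [u, mulVec, dotProduct, mul_comm]
    rw [h1, EuclideanSpace.norm_sq_eq, hA, ← mulVec_mulVec, dotProduct_mulVec, vecMul_transpose]
    simp [dotProduct, sq]
  have hui : ∀ i, ‖u i‖ ^ 2 = U i i := by
    intro i
    have := hu (Pi.single i 1)
    simpa [Pi.single_apply] using this
  have huS : ∀ S : Finset (Fin n), ∑ i ∈ S, u i = ∑ i, ind S i • u i := by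
    intro S; simp [hind]
  have hUle : ∀ i, (e i)⁻¹ ≤ 2 * U i i := by
    intro i
    have hi := hepos i
    rw [inv_le_iff_one_le_mul₀ hi]
    linarith [hst1 i]
  refine ⟨u, fun i => ?_, fun c => ?_, fun S hSm => ?_, ?_⟩
  · have h1 := hle (Pi.single i 1)
    rw [← hu] at h1
    simp [Pi.single_apply] at h1
    have h2 : (e i)⁻¹ ≤ 1 := inv_le_one_of_one_le₀ (he i)
    have h3 : ‖u i‖ ^ 2 ≤ 1 := h1.trans h2
    nlinarith [norm_nonneg (u i)]
  · rw [hu, Finset.mul_sum]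
    refine (hle c).trans (Finset.sum_le_sum fun i _ => ?_)
    rw [hui]
    nlinarith [hUle i, sq_nonneg (c i)]
  · rw [huS, hu]; exact hS S hSm
  · have h1 : ∀ i, 1 - 2 * (1 - e i * U i i) ≤ ‖u i‖ ^ 2 := by
      intro i
      rcases (he i).eq_or_lt with h | h
      · have h2 := hle (Pi.single i 1)
        rw [← hu] at h2
        simp [Pi.single_apply] at h2
        rw [← h] at h2 ⊢
        rw [hui] at h2 ⊢
        norm_num at h2
        linarith
      · have := hst2 i h
        have := sq_nonneg ‖u i‖
        linarith
    have h2 := Finset.sum_le_sum (s := Finset.univ) fun i _ => h1 i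
    have h3 : ∑ i, (1 - 2 * (1 - e i * U i i)) = 2 * ∑ i, e i * U i i - n := by
      rw [Finset.mul_sum]
      have : ∀ i, 1 - 2 * (1 - e i * U i i) = 2 * (e i * U i i) - 1 := fun i => by ring
      simp [this]
    linarith

lemma card_bound (n t : ℕ) (ht : 1 ≤ t)
    (ℬ ℒ : Finset (Finset (Fin n)))
    (hdeg : ∀ i : Fin n, ((ℬ ∪ ℒ).filter fun S => i ∈ S).card ≤ t)
    (hbig : ∀ S ∈ ℬ, 6 * t ≤ S.card) : 6 * ℬ.card ≤ n := by
  have h1 : ∑ S ∈ ℬ, S.card = ∑ i : Fin n, (ℬ.filter fun S => i ∈ S).card := by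
    simp only [Finset.card_filter]
    rw [Finset.sum_comm]
    refine Finset.sum_congr rfl fun S _ => ?_
    simp
  have h2 : ∑ i : Fin n, (ℬ.filter fun S => i ∈ S).card ≤ ∑ i : Fin n, t := by
    refine Finset.sum_le_sum fun i _ => le_trans (Finset.card_le_card ?_) (hdeg i)
    exact Finset.filter_subset_filter _ Finset.subset_union_left
  have h3 : ∑ S ∈ ℬ, 6 * t ≤ ∑ S ∈ ℬ, S.card := Finset.sum_le_sum hbig
  simp at h2 h3
  have : t * (6 * ℬ.card) ≤ t * n := by nlinarith
  exact Nat.le_of_mul_le_mul_left this ht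

end helpers

/-- SDP feasibility with large value: if every element of `{1,…,n}` lies in at
most `t` sets of `ℬ ∪ ℒ` and every set of `ℬ` has at least `6t` elements, and
`|xᵢ| ≤ 1`, then there are vectors `u₁,…,u_n ∈ ℝⁿ` with `‖uᵢ‖ ≤ 1`, zero sum on
each big set, satisfying the proportional discrepancy and approximate
orthogonality constraints on each small set, and with total squared norm at
least `n/3`. -/
theorem sdp_feasibility (n t : ℕ) (hn : 1 ≤ n) (ht : 1 ≤ t)
    (ℬ ℒ : Finset (Finset (Fin n)))
    (hdeg : ∀ i : Fin n, ((ℬ ∪ ℒ).filter fun S => i ∈ S).card ≤ t)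
    (hbig : ∀ S ∈ ℬ, 6 * t ≤ S.card)
    (x : Fin n → ℝ) (hx : ∀ i, |x i| ≤ 1) :
    ∃ u : Fin n → EuclideanSpace ℝ (Fin n),
      (∀ i, ‖u i‖ ≤ 1) ∧
      (∀ S ∈ ℬ, ∑ i ∈ S, u i = 0) ∧
      (∀ S ∈ ℒ, ‖∑ i ∈ S, u i‖ ^ 2 ≤ 2 * ∑ i ∈ S, ‖u i‖ ^ 2) ∧
      (∀ S ∈ ℒ, ‖∑ i ∈ S, x i • u i‖ ^ 2 ≤ 2 * ∑ i ∈ S, ‖u i‖ ^ 2) ∧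
      (n : ℝ) / 3 ≤ ∑ i : Fin n, ‖u i‖ ^ 2 := by
  have hcard := card_bound n t ht ℬ ℒ hdeg hbig
  have hcardR : 6 * (ℬ.card : ℝ) ≤ n := by exact_mod_cast hcard
  set C : Set (Fin n → EuclideanSpace ℝ (Fin n)) :=
    {u | (∀ i, ‖u i‖ ≤ 1) ∧ (∀ S ∈ ℒ, ‖∑ i ∈ S, u i‖ ^ 2 ≤ 2 * ∑ i ∈ S, ‖u i‖ ^ 2) ∧
      (∀ S ∈ ℒ, ‖∑ i ∈ S, x i • u i‖ ^ 2 ≤ 2 * ∑ i ∈ S, ‖u i‖ ^ 2) ∧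
      (n : ℝ) / 3 ≤ ∑ i : Fin n, ‖u i‖ ^ 2} with hC
  have happ : ∀ l : ℝ, 0 < l → ∃ u ∈ C, ∀ S ∈ ℬ, ‖∑ i ∈ S, u i‖ ^ 2 ≤ l := by
    intro l hl
    obtain ⟨u, h1, h2, h3, h4⟩ := approx ℬ l hl
    refine ⟨u, ⟨h1, fun S _ => ?_, fun S _ => ?_, by linarith⟩, h3⟩
    · have := h2 (fun i => if i ∈ S then 1 else 0)
      simpa using this
    · have h := h2 (fun i => if i ∈ S then x i else 0)
      simp only [ite_smul, zero_smul, Finset.sum_ite_mem, Finset.univ_inter, ite_pow,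
        ite_mul, ne_eq, OfNat.ofNat_ne_zero, not_false_eq_true, zero_pow, zero_mul] at h
      refine h.trans ?_
      gcongr with i hi
      have hxi : x i ^ 2 ≤ 1 := (sq_le_one_iff_abs_le_one _).2 (hx i)
      nlinarith [sq_nonneg ‖u i‖]
  have hclosed : IsClosed C := by
    simp only [hC, Set.ofPred_and, Set.ofPred_forall]
    refine IsClosed.inter ?_ (IsClosed.inter ?_ (IsClosed.inter ?_ ?_))
    · exact isClosed_iInter fun i => isClosed_le (by fun_prop) (by fun_prop)
    · exact isClosed_iInter fun S => isClosed_iInter fun _ =>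
        isClosed_le (by fun_prop) (by fun_prop)
    · exact isClosed_iInter fun S => isClosed_iInter fun _ =>
        isClosed_le (by fun_prop) (by fun_prop)
    · exact isClosed_le (by fun_prop) (by fun_prop)
  have hcompact : IsCompact C := by
    refine (isCompact_closedBall (0 : Fin n → EuclideanSpace ℝ (Fin n)) 1).of_isClosed_subset
      hclosed fun u hu => ?_
    rw [mem_closedBall_zero_iff, pi_norm_le_iff_of_nonneg zero_le_one]
    exact hu.1
  obtain ⟨u1, hu1, _⟩ := happ 1 one_pos
  obtain ⟨u, hu, hmin⟩ := hcompact.exists_isMinOn ⟨u1, hu1⟩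
    (f := fun u => ∑ S ∈ ℬ, ‖∑ i ∈ S, u i‖ ^ 2) (by fun_prop)
  have hmin' : ∀ v ∈ C, ∑ S ∈ ℬ, ‖∑ i ∈ S, u i‖ ^ 2 ≤ ∑ S ∈ ℬ, ‖∑ i ∈ S, v i‖ ^ 2 := hmin
  have hzero : ∑ S ∈ ℬ, ‖∑ i ∈ S, u i‖ ^ 2 ≤ 0 := by
    refine le_of_forall_pos_le_add fun ε hε => ?_
    obtain ⟨v, hv, hvS⟩ := happ (ε / (ℬ.card + 1)) (by positivity)
    refine (hmin' v hv).trans ((Finset.sum_le_sum hvS).trans ?_)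
    rw [Finset.sum_const, nsmul_eq_mul, zero_add, mul_div_assoc', div_le_iff₀ (by positivity)]
    nlinarith
  refine ⟨u, hu.1, fun S hS => ?_, hu.2.1, hu.2.2.1, hu.2.2.2⟩
  have h1 := Finset.single_le_sum (f := fun S => ‖∑ i ∈ S, u i‖ ^ 2)
    (fun T _ => by positivity) hS
  have h2 : ‖∑ i ∈ S, u i‖ ^ 2 ≤ 0 := h1.trans hzero
  have h3 : ‖∑ i ∈ S, u i‖ ^ 2 = 0 := le_antisymm h2 (by positivity)
  exact norm_eq_zero.1 (pow_eq_zero_iff two_ne_zero |>.1 h3)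
end
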